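/- arXiv:1602.00512 — 9 statements merged into one kernel-verified Lean document; each statement's English description precedes it below -/
import Mathlib

section
/- Let s ∈ [1, ∞), let μ be a measure on a measurable space E, let θ : E → (0, ∞) be measurable with 0 < ∫_E θ dμ < ∞, and let (X(x))_{x ∈ E} be a jointly measurable family of nonnegative random variables (i.e. (x, ω) ↦ X(x)(ω) is measurable) such that X(x) ≤ O_s(θ(x)) for every x ∈ E. Then the random variable ω ↦ ∫_E X(x)(ω) dμ(x) (defined in [0,∞]) is almost surely finite and satisfies ∫_E X dμ ≤ O_s(∫_E θ dμ), i.e. 𝔼[exp(((∫_E X dμ)/(∫_E θ dμ))^s)] ≤ 2. -/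
open MeasureTheory

theorem convexOn_exp_rpow {s : ℝ} (hs : 1 ≤ s) :
    ConvexOn ℝ (Set.Ici 0) fun z : ℝ => Real.exp (z ^ s) := by
  refine ⟨convex_Ici 0, fun x hx y hy a b ha hb hab => ?_⟩
  have h := (convexOn_rpow hs).2 hx hy ha hb hab
  exact (Real.exp_le_exp.2 h).trans
    (convexOn_exp.2 (Set.mem_univ (x ^ s)) (Set.mem_univ (y ^ s)) ha hb hab)

theorem continuous_exp_rpow {s : ℝ} (hs : 1 ≤ s) :
    Continuous fun z : ℝ => Real.exp (z ^ s) :=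
  Real.continuous_exp.comp (Real.continuous_rpow_const (by linarith))

theorem le_exp_rpow {s z : ℝ} (hs : 1 ≤ s) (hz : 0 ≤ z) : z ≤ Real.exp (z ^ s) := by
  have hzs : 0 ≤ z ^ s := Real.rpow_nonneg hz s
  have hexp := Real.add_one_le_exp (z ^ s)
  rcases le_total z 1 with h | h
  · linarith
  · have := Real.self_le_rpow_of_one_le h hs
    linarith

/-- Jensen's inequality for `z ↦ exp (z ^ s)` and the lower Lebesgue integral. -/
theorem ofReal_exp_rpow_toReal_lintegral_le {E : Type*} [MeasurableSpace E] (P : Measure E)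
    [IsProbabilityMeasure P] {s : ℝ} (hs : 1 ≤ s) {f : E → ℝ} (hf : Measurable f)
    (hf0 : ∀ x, 0 ≤ f x) (hfin : ∫⁻ x, ENNReal.ofReal (f x) ∂P < ⊤) :
    ENNReal.ofReal (Real.exp ((∫⁻ x, ENNReal.ofReal (f x) ∂P).toReal ^ s)) ≤
      ∫⁻ x, ENNReal.ofReal (Real.exp (f x ^ s)) ∂P := by
  have hmeas : Measurable fun x => Real.exp (f x ^ s) :=
    (continuous_exp_rpow hs).measurable.comp hf
  rcases eq_or_ne (∫⁻ x, ENNReal.ofReal (Real.exp (f x ^ s)) ∂P) ⊤ with htop | htop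
  · simp [htop]
  have hfi : Integrable f P :=
    (lintegral_ofReal_ne_top_iff_integrable hf.aestronglyMeasurable
      (Filter.Eventually.of_forall hf0)).1 hfin.ne
  have hgi : Integrable (fun x => Real.exp (f x ^ s)) P :=
    (lintegral_ofReal_ne_top_iff_integrable hmeas.aestronglyMeasurable
      (Filter.Eventually.of_forall fun x => (Real.exp_pos _).le)).1 htop
  rw [← integral_eq_lintegral_of_nonneg_ae (Filter.Eventually.of_forall hf0)
      hf.aestronglyMeasurable,
    ← ofReal_integral_eq_lintegral_ofReal hgi
      (Filter.Eventually.of_forall fun x => (Real.exp_pos _).le)]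
  exact ENNReal.ofReal_le_ofReal ((convexOn_exp_rpow hs).map_integral_le
    (continuous_exp_rpow hs).continuousOn isClosed_Ici (Filter.Eventually.of_forall hf0) hfi hgi)

/-- Let `s ≥ 1`, `μ` (here `ν`) a measure on a measurable space `E`, `θ : E → (0,∞)`
measurable with `0 < ∫ θ dν < ∞`, and `(X x)_{x ∈ E}` a jointly measurable family of
nonnegative random variables with `X x ≤ O_s(θ x)` for every `x` (i.e.
`𝔼[exp(((θ x)⁻¹ max(X x, 0))^s)] ≤ 2`). Then `ω ↦ ∫ X x ω dν x` (defined in `[0,∞]`) is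
almost surely finite and `∫ X dν ≤ O_s(∫ θ dν)`, i.e.
`𝔼[exp(((∫ X dν)/(∫ θ dν))^s)] ≤ 2`. -/
theorem stmt_4 {Ω : Type*} [MeasurableSpace Ω] (μ : Measure Ω) [IsProbabilityMeasure μ]
    {E : Type*} [MeasurableSpace E] (ν : Measure E)
    (s : ℝ) (hs : 1 ≤ s)
    (θ : E → ℝ) (hθmeas : Measurable θ) (hθpos : ∀ x, 0 < θ x)
    (hθint : Integrable θ ν) (hθIpos : 0 < ∫ x, θ x ∂ν)
    (X : E → Ω → ℝ) (hXmeas : Measurable (Function.uncurry X)) (hXnn : ∀ x ω, 0 ≤ X x ω)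
    (hX : ∀ x, (∫⁻ ω, ENNReal.ofReal (Real.exp (((θ x)⁻¹ * max (X x ω) 0) ^ s)) ∂μ) ≤ 2) :
    (∀ᵐ ω ∂μ, (∫⁻ x, ENNReal.ofReal (X x ω) ∂ν) < ⊤) ∧
      (∫⁻ ω, ENNReal.ofReal (Real.exp
        (((∫⁻ x, ENNReal.ofReal (X x ω) ∂ν).toReal / ∫ x, θ x ∂ν) ^ s)) ∂μ) ≤ 2 := by
  set I := ∫ x, θ x ∂ν with hI
  let ρ : E → ENNReal := fun x => ENNReal.ofReal (θ x / I)
  have hρ : Measurable ρ := (hθmeas.div_const I).ennreal_ofReal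
  let P := ν.withDensity ρ
  have hP : IsProbabilityMeasure P := by
    refine ⟨?_⟩
    rw [withDensity_apply _ MeasurableSet.univ, Measure.restrict_univ,
      ← ofReal_integral_eq_lintegral_ofReal (hθint.div_const I)
        (Filter.Eventually.of_forall fun x => (div_pos (hθpos x) hθIpos).le),
      integral_div, div_self hθIpos.ne', ENNReal.ofReal_one]
  let Z : E → Ω → ℝ := fun x ω => (θ x)⁻¹ * X x ω
  have hZ0 : ∀ x ω, 0 ≤ Z x ω := fun x ω => mul_nonneg (inv_nonneg.2 (hθpos x).le) (hXnn x ω)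
  have hZ : Measurable fun p : E × Ω => Z p.1 p.2 :=
    (hθmeas.comp measurable_fst).inv.mul hXmeas
  have hZω : ∀ ω, Measurable fun x => Z x ω := fun ω => hZ.comp measurable_prodMk_right
  have hφ : Measurable fun p : E × Ω => ENNReal.ofReal (Real.exp (Z p.1 p.2 ^ s)) :=
    ((continuous_exp_rpow hs).measurable.comp hZ).ennreal_ofReal
  have hX' : ∀ x, ∫⁻ ω, ENNReal.ofReal (Real.exp (Z x ω ^ s)) ∂μ ≤ 2 := fun x => by
    simpa only [Z, max_eq_left (hXnn x _)] using hX x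
  have key : ∀ ω, ∫⁻ x, ENNReal.ofReal (X x ω) ∂ν =
      ENNReal.ofReal I * ∫⁻ x, ENNReal.ofReal (Z x ω) ∂P := fun ω => by
    rw [lintegral_withDensity_eq_lintegral_mul _ hρ (hZω ω).ennreal_ofReal,
      ← lintegral_const_mul _ (hρ.mul (hZω ω).ennreal_ofReal)]
    refine lintegral_congr fun x => ?_
    have hθx := (hθpos x).ne'
    have hI0 := hθIpos.ne'
    simp only [Pi.mul_apply, ρ]
    rw [← ENNReal.ofReal_mul (div_pos (hθpos x) hθIpos).le, ← ENNReal.ofReal_mul hθIpos.le]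
    congr 1
    simp only [Z]
    field_simp
  have hbound : ∫⁻ ω, ∫⁻ x, ENNReal.ofReal (Real.exp (Z x ω ^ s)) ∂P ∂μ ≤ 2 := by
    rw [lintegral_lintegral_swap (f := fun ω x => ENNReal.ofReal (Real.exp (Z x ω ^ s)))
      (hφ.comp measurable_swap).aemeasurable]
    calc ∫⁻ x, ∫⁻ ω, ENNReal.ofReal (Real.exp (Z x ω ^ s)) ∂μ ∂P
        ≤ ∫⁻ _, 2 ∂P := lintegral_mono hX'
      _ = 2 := by simp
  have hfin : ∀ᵐ ω ∂μ, ∫⁻ x, ENNReal.ofReal (Z x ω) ∂P < ⊤ := by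
    have h := ae_lt_top hφ.lintegral_prod_left' (hbound.trans_lt ENNReal.ofNat_lt_top).ne
    filter_upwards [h] with ω hω
    exact (lintegral_mono fun x =>
      ENNReal.ofReal_le_ofReal (le_exp_rpow hs (hZ0 x ω))).trans_lt hω
  refine ⟨?_, ?_⟩
  · filter_upwards [hfin] with ω hω
    rw [key]
    exact ENNReal.mul_lt_top ENNReal.ofReal_lt_top hω
  · refine (lintegral_mono_ae ?_).trans hbound
    filter_upwards [hfin] with ω hω
    rw [key, ENNReal.toReal_mul, ENNReal.toReal_ofReal hθIpos.le,
      mul_div_cancel_left₀ _ hθIpos.ne']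
    exact ofReal_exp_rpow_toReal_lintegral_le P hs (hZω ω) (fun x => hZ0 x ω) hω
end

section
/- Let s ∈ (1, 2]. There exists a constant C(s) < ∞ such that every real random variable X satisfying X = Ō_s(1) also satisfies X = O_s(C). -/
open MeasureTheory

/-- `X = Ō_s(θ)`: for every `λ ∈ ℝ`, `log 𝔼[exp(λ θ⁻¹ X)] ≤ max(λ², |λ|^(s/(s-1)))`,
i.e. `𝔼[exp(λ θ⁻¹ X)] ≤ exp (max(λ², |λ|^(s/(s-1))))`. -/
def barO {Ω : Type*} [MeasurableSpace Ω] (μ : Measure Ω) (s θ : ℝ) (X : Ω → ℝ) : Prop :=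
  ∀ lam : ℝ,
    (∫⁻ ω, ENNReal.ofReal (Real.exp (lam * θ⁻¹ * X ω)) ∂μ) ≤
      ENNReal.ofReal (Real.exp (max (lam ^ 2) (|lam| ^ (s / (s - 1)))))

/-- Jensen's inequality for the concave power `r ≤ 1`; no measurability is needed, since the
lower Lebesgue integral is attained by a measurable minorant. -/
theorem lintegral_rpow_le_rpow_lintegral {Ω : Type*} [MeasurableSpace Ω] (μ : Measure Ω)
    [IsProbabilityMeasure μ] (F : Ω → ENNReal) {r : ℝ} (hr : 0 < r) (hr1 : r ≤ 1) :
    (∫⁻ ω, F ω ^ r ∂μ) ≤ (∫⁻ ω, F ω ∂μ) ^ r := by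
  obtain ⟨h, hm, hle, heq⟩ := exists_measurable_le_lintegral_eq μ (fun ω => F ω ^ r)
  rw [heq]
  have hp : 1 ≤ 1 / r := by rw [le_div_iff₀ hr]; linarith
  have key : (∫⁻ ω, h ω ∂μ) ≤ (∫⁻ ω, h ω ^ (1 / r) ∂μ) ^ r := by
    rcases eq_or_lt_of_le hp with h1 | h1
    · have : r = 1 := by field_simp at h1; linarith
      subst this; simp
    · have hc : (1 / r).HolderConjugate (Real.conjExponent (1 / r)) :=
        Real.HolderConjugate.conjExponent h1
      have := ENNReal.lintegral_mul_le_Lp_mul_Lq μ hc hm.aemeasurable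
        (aemeasurable_const (b := (1 : ENNReal)))
      simpa using this
  refine key.trans (ENNReal.rpow_le_rpow (lintegral_mono fun ω => ?_) hr.le)
  calc h ω ^ (1 / r) ≤ (F ω ^ r) ^ (1 / r) :=
        ENNReal.rpow_le_rpow (hle ω) (by positivity)
    _ = F ω := by
        rw [← ENNReal.rpow_mul, mul_one_div_cancel hr.ne', ENNReal.rpow_one]

/-- Chernoff's bound on a measurable set, for a possibly non-measurable function. -/
theorem exp_mul_measure_le_lintegral_exp {Ω : Type*} [MeasurableSpace Ω] (μ : Measure Ω)
    (Z : Ω → ℝ) {A : Set Ω} (hA : MeasurableSet A) {l t : ℝ} (hl : 0 ≤ l)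
    (hZ : ∀ ω ∈ A, t ≤ Z ω) :
    ENNReal.ofReal (Real.exp (l * t)) * μ A ≤
      ∫⁻ ω, ENNReal.ofReal (Real.exp (l * Z ω)) ∂μ := by
  rw [← setLIntegral_const]
  refine (setLIntegral_mono' hA fun ω hω => ?_).trans (setLIntegral_le_lintegral A _)
  exact ENNReal.ofReal_le_ofReal
    (Real.exp_le_exp.2 (mul_le_mul_of_nonneg_left (hZ ω hω) hl))

theorem max_sq_rpow_conj_le {s u : ℝ} (hs1 : 1 < s) (hs2 : s ≤ 2) (hu : 0 ≤ u) :
    max ((u ^ (s - 1)) ^ 2) ((u ^ (s - 1)) ^ (s / (s - 1))) ≤ 1 + u ^ s := by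
  have hs : 0 < s - 1 := by linarith
  have h2 : (u ^ (s - 1)) ^ (s / (s - 1)) = u ^ s := by
    rw [← Real.rpow_mul hu, mul_div_cancel₀ _ hs.ne']
  have hus : 0 ≤ u ^ s := by positivity
  rw [h2]
  refine max_le ?_ (by linarith)
  rw [← Real.rpow_natCast, ← Real.rpow_mul hu]
  rcases le_total u 1 with h | h
  · have := Real.rpow_le_one hu h (z := (s - 1) * ((2 : ℕ) : ℝ)) (by positivity)
    linarith
  · have := Real.rpow_le_rpow_of_exponent_le h
      (show (s - 1) * ((2 : ℕ) : ℝ) ≤ s by push_cast; linarith)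
    linarith

theorem layer_exponent_le {s : ℝ} (hs1 : 1 < s) {k : ℕ} (hk : 1 ≤ k) :
    (((k : ℝ) + 1) / 8) ^ s + (1 + ((k : ℝ) / 2) ^ s) -
      ((k : ℝ) / 2) ^ (s - 1) * k ≤ 2 - k / 4 := by
  have hk' : (1 : ℝ) ≤ k := by exact_mod_cast hk
  have hu : (0 : ℝ) < k / 2 := by linarith
  have h1 : ((k : ℝ) / 2) ^ (s - 1) * k = 2 * ((k : ℝ) / 2) ^ s := by
    rw [Real.rpow_sub hu, Real.rpow_one]; field_simp
  have h2 : (((k : ℝ) + 1) / 8) ^ s ≤ ((k : ℝ) / 2) ^ s * (1 / 2) := by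
    calc (((k : ℝ) + 1) / 8) ^ s ≤ ((k : ℝ) / 2 * (1 / 2)) ^ s :=
          Real.rpow_le_rpow (by positivity) (by linarith) (by linarith)
      _ = ((k : ℝ) / 2) ^ s * (1 / 2) ^ s := Real.mul_rpow hu.le (by norm_num)
      _ ≤ ((k : ℝ) / 2) ^ s * (1 / 2) := by
          gcongr
          simpa using Real.rpow_le_rpow_of_exponent_ge (x := (1 / 2 : ℝ)) (by norm_num)
            (by norm_num) hs1.le
  have h3 : (k : ℝ) / 2 - 1 ≤ ((k : ℝ) / 2) ^ s := by
    rcases le_total ((k : ℝ) / 2) 1 with h | h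
    · have : 0 ≤ ((k : ℝ) / 2) ^ s := by positivity
      linarith
    · have := Real.self_le_rpow_of_one_le h hs1.le
      linarith
  linarith

theorem tsum_ofReal_exp_two_sub_div_four_ne_top :
    (∑' k : ℕ, ENNReal.ofReal (Real.exp (2 - (k : ℝ) / 4))) ≠ ⊤ := by
  have hs : Summable fun k : ℕ => Real.exp (2 - (k : ℝ) / 4) := by
    have := (Real.summable_exp_nat_mul_iff.2 (show (-1 / 4 : ℝ) < 0 by norm_num)).mul_left
      (Real.exp 2)
    refine this.congr fun k => ?_
    rw [← Real.exp_add]; congr 1; ring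
  rw [← ENNReal.ofReal_tsum_of_nonneg (fun k => (Real.exp_pos _).le) hs]
  exact ENNReal.ofReal_ne_top

/-- Chernoff bounds at the integer levels `k`, with `l = (k / 2) ^ (s - 1)`, sum to a bound on the
stretched exponential moment that depends on neither `Z` nor `s`. -/
theorem lintegral_exp_rpow_le_tsum {Ω : Type*} [MeasurableSpace Ω] (μ : Measure Ω)
    [IsProbabilityMeasure μ] {s : ℝ} (hs1 : 1 < s) (hs2 : s ≤ 2) (Z : Ω → ℝ)
    (hZ : ∀ l : ℝ, 0 ≤ l → (∫⁻ ω, ENNReal.ofReal (Real.exp (l * Z ω)) ∂μ) ≤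
      ENNReal.ofReal (Real.exp (max (l ^ 2) (l ^ (s / (s - 1)))))) :
    (∫⁻ ω, ENNReal.ofReal (Real.exp ((max (Z ω) 0 / 8) ^ s)) ∂μ) ≤
      ∑' k : ℕ, ENNReal.ofReal (Real.exp (2 - (k : ℝ) / 4)) := by
  have hs0 : 0 < s := by linarith
  obtain ⟨g, hgm, hle, heq⟩ := exists_measurable_le_lintegral_eq μ
    (fun ω => ENNReal.ofReal (Real.exp ((max (Z ω) 0 / 8) ^ s)))
  rw [heq]
  let a : ℕ → ENNReal := fun k => ENNReal.ofReal (Real.exp (((k : ℝ) / 8) ^ s))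
  let A : ℕ → Set Ω := fun k => if k = 0 then Set.univ else {ω | a k ≤ g ω}
  have hA : ∀ k, MeasurableSet (A k) := fun k => by
    by_cases hk : k = 0
    · simp [A, hk]
    · simpa [A, hk] using measurableSet_le measurable_const hgm
  have hAZ : ∀ k, 1 ≤ k → ∀ ω ∈ A k, (k : ℝ) ≤ Z ω := fun k hk ω hω => by
    have hk0 : k ≠ 0 := by omega
    have hω' : a k ≤ g ω := by simpa [A, hk0] using hω
    have h1 := hω'.trans (hle ω)
    rw [ENNReal.ofReal_le_ofReal_iff (Real.exp_pos _).le, Real.exp_le_exp,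
      Real.rpow_le_rpow_iff (by positivity) (by positivity) hs0] at h1
    have h2 : (k : ℝ) ≤ max (Z ω) 0 := by linarith
    rcases le_max_iff.1 h2 with h | h
    · exact h
    · have : (1 : ℝ) ≤ k := by exact_mod_cast hk
      linarith
  have hpt : ∀ ω, g ω ≤ ∑' k, (A k).indicator (fun _ => a (k + 1)) ω := fun ω => by
    have hex : ∃ k : ℕ, g ω ≤ a (k + 1) := by
      obtain ⟨n, hn⟩ := exists_nat_ge (max (Z ω) 0)
      refine ⟨n, (hle ω).trans ?_⟩
      refine ENNReal.ofReal_le_ofReal (Real.exp_le_exp.2 ?_)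
      refine Real.rpow_le_rpow (by positivity) ?_ hs0.le
      push_cast
      linarith
    classical
    have hmem : ω ∈ A (Nat.find hex) := by
      by_cases hk : Nat.find hex = 0
      · simp [A, hk]
      · have hmin := Nat.find_min hex (show Nat.find hex - 1 < Nat.find hex by omega)
        rw [Nat.sub_add_cancel (by omega)] at hmin
        simpa only [A, if_neg hk, Set.mem_ofPred_eq] using (not_le.1 hmin).le
    calc g ω ≤ a (Nat.find hex + 1) := Nat.find_spec hex
      _ = (A (Nat.find hex)).indicator (fun _ => a (Nat.find hex + 1)) ω := by
          rw [Set.indicator_of_mem hmem]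
      _ ≤ _ := ENNReal.le_tsum (f := fun k => (A k).indicator (fun _ => a (k + 1)) ω) _
  refine (lintegral_mono hpt).trans ?_
  rw [lintegral_tsum fun k => (measurable_const.indicator (hA k)).aemeasurable]
  refine ENNReal.tsum_le_tsum fun k => ?_
  rw [lintegral_indicator_const (hA k)]
  rcases Nat.eq_zero_or_pos k with rfl | hk
  · refine (mul_le_of_le_one_right' prob_le_one).trans ?_
    refine ENNReal.ofReal_le_ofReal (Real.exp_le_exp.2 ?_)
    have := Real.rpow_le_one (x := (((0 + 1 : ℕ) : ℝ) / 8)) (by positivity) (by norm_num) hs0.le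
    push_cast at this ⊢
    linarith
  · have hl : (0 : ℝ) ≤ ((k : ℝ) / 2) ^ (s - 1) := by positivity
    have h := (exp_mul_measure_le_lintegral_exp μ Z (hA k) hl (hAZ k hk)).trans (hZ _ hl)
    have h1 := h.trans (ENNReal.ofReal_le_ofReal
      (Real.exp_le_exp.2 (max_sq_rpow_conj_le hs1 hs2 (by positivity : (0 : ℝ) ≤ (k : ℝ) / 2))))
    have h2 : a (k + 1) = ENNReal.ofReal (Real.exp ((((k : ℝ) + 1) / 8) ^ s -
        ((k : ℝ) / 2) ^ (s - 1) * k)) *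
        ENNReal.ofReal (Real.exp (((k : ℝ) / 2) ^ (s - 1) * k)) := by
      rw [← ENNReal.ofReal_mul (Real.exp_pos _).le, ← Real.exp_add]
      simp [a]
    rw [h2, mul_assoc]
    refine (mul_le_mul_right h1 _).trans ?_
    rw [← ENNReal.ofReal_mul (Real.exp_pos _).le, ← Real.exp_add]
    refine ENNReal.ofReal_le_ofReal (Real.exp_le_exp.2 ?_)
    have := layer_exponent_le hs1 hk
    linarith

/-- Let `s ∈ (1, 2]`. There exists `C(s) < ∞` such that every real random variable `X`
satisfying `X = Ō_s(1)` also satisfies `X = O_s(C)`, i.e. both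
`𝔼[exp((C⁻¹ max(X,0))^s)] ≤ 2` and `𝔼[exp((C⁻¹ max(-X,0))^s)] ≤ 2`. -/
theorem stmt_6 (s : ℝ) (hs1 : 1 < s) (hs2 : s ≤ 2) :
    ∃ C : ℝ, 0 < C ∧
      ∀ (Ω : Type*) [MeasurableSpace Ω] (μ : Measure Ω) [IsProbabilityMeasure μ]
        (X : Ω → ℝ), barO μ s 1 X →
        ((∫⁻ ω, ENNReal.ofReal (Real.exp ((C⁻¹ * max (X ω) 0) ^ s)) ∂μ) ≤ 2 ∧
          (∫⁻ ω, ENNReal.ofReal (Real.exp ((C⁻¹ * max (-X ω) 0) ^ s)) ∂μ) ≤ 2) := by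
  obtain ⟨N, hN⟩ : ∃ N : ℕ,
      (∑' k : ℕ, ENNReal.ofReal (Real.exp (2 - (k : ℝ) / 4))) ≤ 2 ^ (N + 1) := by
    obtain ⟨n, hn⟩ := ENNReal.exists_nat_gt tsum_ofReal_exp_two_sub_div_four_ne_top
    refine ⟨n, hn.le.trans ?_⟩
    have : n ≤ 2 ^ (n + 1) := (Nat.lt_two_pow_self.le).trans (Nat.pow_le_pow_right (by omega)
      (by omega))
    exact_mod_cast this
  have hs0 : 0 < s := by linarith
  set M : ℝ := (N : ℝ) + 1 with hM
  have hM1 : 1 ≤ M := by have := N.cast_nonneg (α := ℝ); linarith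
  have hM0 : 0 < M := by linarith
  refine ⟨8 * M ^ s⁻¹, by positivity, fun Ω _ μ _ X hX => ?_⟩
  have key : ∀ Z : Ω → ℝ, (∀ l : ℝ, 0 ≤ l →
      (∫⁻ ω, ENNReal.ofReal (Real.exp (l * Z ω)) ∂μ) ≤
        ENNReal.ofReal (Real.exp (max (l ^ 2) (l ^ (s / (s - 1)))))) →
      (∫⁻ ω, ENNReal.ofReal (Real.exp (((8 * M ^ s⁻¹)⁻¹ * max (Z ω) 0) ^ s)) ∂μ) ≤ 2 := by
    intro Z hZ
    have hpow : ∀ ω, ENNReal.ofReal (Real.exp (((8 * M ^ s⁻¹)⁻¹ * max (Z ω) 0) ^ s)) =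
        ENNReal.ofReal (Real.exp ((max (Z ω) 0 / 8) ^ s)) ^ M⁻¹ := fun ω => by
      rw [ENNReal.ofReal_rpow_of_pos (Real.exp_pos _), ← Real.exp_mul]
      congr 2
      have h0 : 0 ≤ max (Z ω) 0 / 8 := by positivity
      have h1 : (8 * M ^ s⁻¹)⁻¹ * max (Z ω) 0 = max (Z ω) 0 / 8 * (M ^ s⁻¹)⁻¹ := by
        field_simp
      rw [h1, Real.mul_rpow h0 (by positivity), Real.inv_rpow (by positivity),
        Real.rpow_inv_rpow hM0.le hs0.ne']
    simp_rw [hpow]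
    calc _ ≤ (∫⁻ ω, ENNReal.ofReal (Real.exp ((max (Z ω) 0 / 8) ^ s)) ∂μ) ^ M⁻¹ :=
          lintegral_rpow_le_rpow_lintegral μ _ (inv_pos.2 hM0) (inv_le_one_of_one_le₀ hM1)
      _ ≤ (2 ^ (N + 1) : ENNReal) ^ M⁻¹ :=
          ENNReal.rpow_le_rpow ((lintegral_exp_rpow_le_tsum μ hs1 hs2 Z hZ).trans hN)
            (inv_pos.2 hM0).le
      _ = 2 := by
          rw [← ENNReal.rpow_natCast, ← ENNReal.rpow_mul]
          push_cast
          rw [mul_inv_cancel₀ hM0.ne', ENNReal.rpow_one]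
  refine ⟨key X fun l hl => ?_, key (fun ω => -X ω) fun l hl => ?_⟩
  · simpa [abs_of_nonneg hl] using hX l
  · simpa [abs_of_nonneg hl] using hX (-l)
end

section
/- Let s ∈ (1, 2]. There exists a constant C(s) < ∞ such that every real random variable X with X = O_s(1) and 𝔼[X] = 0 satisfies X = Ō_s(C); equivalently, for every λ ∈ ℝ, log 𝔼[exp(λ C⁻¹ X)] ≤ max(λ², |λ|^{s/(s−1)}). -/
open MeasureTheory

open Real

/-- A two-sided stretched exponential moment bound gives an integrable, bounded moment of `|X|`. -/
lemma integrable_exp_abs_rpow {Ω : Type*} [MeasurableSpace Ω] {μ : Measure Ω} {s : ℝ}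
    {X : Ω → ℝ} (hX : AEMeasurable X μ)
    (hpos : (∫⁻ ω, ENNReal.ofReal (exp ((max (X ω) 0) ^ s)) ∂μ) ≤ 2)
    (hneg : (∫⁻ ω, ENNReal.ofReal (exp ((max (-X ω) 0) ^ s)) ∂μ) ≤ 2) :
    Integrable (fun ω => exp (|X ω| ^ s)) μ ∧ ∫ ω, exp (|X ω| ^ s) ∂μ ≤ 4 := by
  have hle : (∫⁻ ω, ENNReal.ofReal (exp (|X ω| ^ s)) ∂μ) ≤ 4 := by
    calc (∫⁻ ω, ENNReal.ofReal (exp (|X ω| ^ s)) ∂μ)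
        ≤ ∫⁻ ω, (ENNReal.ofReal (exp ((max (X ω) 0) ^ s)) +
            ENNReal.ofReal (exp ((max (-X ω) 0) ^ s))) ∂μ := by
          refine lintegral_mono fun ω => ?_
          rcases le_total 0 (X ω) with h | h
          · rw [abs_of_nonneg h, max_eq_left h]
            exact le_self_add
          · rw [abs_of_nonpos h, max_eq_left (neg_nonneg.2 h)]
            exact le_add_self
      _ = (∫⁻ ω, ENNReal.ofReal (exp ((max (X ω) 0) ^ s)) ∂μ) +
            ∫⁻ ω, ENNReal.ofReal (exp ((max (-X ω) 0) ^ s)) ∂μ :=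
          lintegral_add_left' (by fun_prop) _
      _ ≤ 2 + 2 := add_le_add hpos hneg
      _ = 4 := by norm_num
  have hnn : 0 ≤ᵐ[μ] fun ω => exp (|X ω| ^ s) := .of_forall fun _ => (exp_pos _).le
  have hm : AEMeasurable (fun ω => exp (|X ω| ^ s)) μ := by fun_prop
  refine ⟨⟨hm.aestronglyMeasurable, ?_⟩, ?_⟩
  · rw [hasFiniteIntegral_iff_ofReal hnn]
    exact hle.trans_lt (by norm_num)
  · rw [integral_eq_lintegral_of_nonneg_ae hnn hm.aestronglyMeasurable]
    exact ENNReal.toReal_le_of_le_ofReal (by norm_num) (by simpa using hle)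

/-- If `f ≤ a + b X + d G` with `X` centered and `∫ G ≤ 4`, then `∫ f ≤ a + 4 d`. -/
lemma lintegral_ofReal_le_of_le_affine {Ω : Type*} [MeasurableSpace Ω] {μ : Measure Ω}
    [IsProbabilityMeasure μ] {f X G : Ω → ℝ} {a b d : ℝ} (hf : ∀ ω, 0 ≤ f ω)
    (hX : Integrable X μ) (hX0 : ∫ ω, X ω ∂μ = 0) (hG : Integrable G μ)
    (hG4 : ∫ ω, G ω ∂μ ≤ 4) (hd : 0 ≤ d) (hle : ∀ ω, f ω ≤ a + b * X ω + d * G ω) :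
    (∫⁻ ω, ENNReal.ofReal (f ω) ∂μ) ≤ ENNReal.ofReal (a + 4 * d) := by
  have hab : Integrable (fun ω => a + b * X ω) μ := (integrable_const a).add (hX.const_mul b)
  calc (∫⁻ ω, ENNReal.ofReal (f ω) ∂μ)
      ≤ ∫⁻ ω, ENNReal.ofReal (a + b * X ω + d * G ω) ∂μ :=
        lintegral_mono fun ω => ENNReal.ofReal_le_ofReal (hle ω)
    _ = ENNReal.ofReal (∫ ω, (a + b * X ω + d * G ω) ∂μ) :=
        (ofReal_integral_eq_lintegral_ofReal (hab.add (hG.const_mul d))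
          (.of_forall fun ω => (hf ω).trans (hle ω))).symm
    _ ≤ ENNReal.ofReal (a + 4 * d) := by
        refine ENNReal.ofReal_le_ofReal ?_
        rw [integral_add hab (hG.const_mul d),
          integral_add (integrable_const a) (hX.const_mul b), integral_const_mul,
          integral_const_mul, hX0]
        simp only [integral_const, probReal_univ, one_smul, mul_zero, add_zero]
        linarith [mul_le_mul_of_nonneg_left hG4 hd]

lemma exp_le_one_add_add_sq_mul_exp_abs (u : ℝ) : exp u ≤ 1 + u + u ^ 2 * exp |u| := by
  have h := Complex.norm_exp_sub_sum_le_norm_mul_exp (u : ℂ) 2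
  have e : Complex.exp u - ∑ m ∈ Finset.range 2, (u : ℂ) ^ m / m.factorial
      = ((exp u - (1 + u) : ℝ) : ℂ) := by
    simp [Finset.sum_range_succ]
  rw [e, Complex.norm_real, Complex.norm_real, norm_eq_abs, norm_eq_abs, sq_abs] at h
  linarith [le_abs_self (exp u - (1 + u))]

/-- Quadratic exponential growth is dominated by the stretched exponential of order `s > 1`. -/
lemma sq_mul_exp_abs_le {s p : ℝ} (hps : p.HolderConjugate s) (x : ℝ) :
    x ^ 2 * exp |x| ≤ 2 * exp (2 ^ p) * exp (|x| ^ s) := by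
  have h1 : x ^ 2 ≤ 2 * exp |x| := by
    have := quadratic_le_exp_of_nonneg (abs_nonneg x)
    rw [sq_abs] at this
    linarith [abs_nonneg x]
  have h2 : |x| + |x| ≤ 2 ^ p + |x| ^ s := by
    have h := young_inequality_of_nonneg zero_le_two (abs_nonneg x) hps
    have h3 : (2 : ℝ) ^ p / p ≤ 2 ^ p := div_le_self (by positivity) hps.lt.le
    have h4 : |x| ^ s / s ≤ |x| ^ s := div_le_self (by positivity) hps.symm.lt.le
    linarith
  calc x ^ 2 * exp |x| ≤ 2 * exp |x| * exp |x| := by gcongr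
    _ = 2 * exp (|x| + |x|) := by rw [exp_add]; ring
    _ ≤ 2 * exp (2 ^ p + |x| ^ s) := by gcongr
    _ = 2 * exp (2 ^ p) * exp (|x| ^ s) := by rw [exp_add]; ring

/-- Pointwise bound for `|t| ≤ 1`, keeping the linear term exact. -/
lemma exp_mul_le_of_abs_le_one {s p : ℝ} (hps : p.HolderConjugate s) {t : ℝ} (ht : |t| ≤ 1)
    (x : ℝ) : exp (t * x) ≤ 1 + t * x + t ^ 2 * (2 * exp (2 ^ p)) * exp (|x| ^ s) := by
  have h : exp |t * x| ≤ exp |x| := by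
    rw [abs_mul]
    exact exp_le_exp.2 (mul_le_of_le_one_left (abs_nonneg x) ht)
  calc exp (t * x) ≤ 1 + t * x + (t * x) ^ 2 * exp |t * x| :=
        exp_le_one_add_add_sq_mul_exp_abs _
    _ ≤ 1 + t * x + (t * x) ^ 2 * exp |x| := by gcongr
    _ = 1 + t * x + t ^ 2 * (x ^ 2 * exp |x|) := by ring
    _ ≤ 1 + t * x + t ^ 2 * (2 * exp (2 ^ p) * exp (|x| ^ s)) := by
        gcongr 1 + t * x + t ^ 2 * ?_
        exact sq_mul_exp_abs_le hps x
    _ = _ := by ring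

lemma exp_div_six_le (v : ℝ) : exp (v / 6) ≤ 5 / 6 + exp v / 6 := by
  have h := convexOn_exp.2 (Set.mem_univ 0) (Set.mem_univ v)
    (by norm_num : (0 : ℝ) ≤ 5 / 6) (by norm_num : (0 : ℝ) ≤ 1 / 6) (by norm_num)
  simp only [smul_eq_mul, mul_zero, zero_add, exp_zero] at h
  rw [show v / 6 = 1 / 6 * v by ring]
  linarith

/-- Pointwise bound obtained from the Young inequality. -/
lemma exp_mul_inv_mul_le {s p : ℝ} (hps : p.HolderConjugate s) (hp : 2 ≤ p) {c : ℝ}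
    (hc : 6 ≤ c) (l x : ℝ) :
    exp (l * c⁻¹ * x) ≤ exp (|l| ^ p / 2) * (5 / 6 + exp (|x| ^ s) / 6) := by
  have hs : 1 < s := hps.symm.lt
  have hc0 : 0 < c := by linarith
  have hcs : 6 ≤ c ^ s := hc.trans (self_le_rpow_of_one_le (by linarith) hs.le)
  have young := young_inequality l (c⁻¹ * x) hps
  have h1 : |l| ^ p / p ≤ |l| ^ p / 2 := by gcongr
  have h2 : |c⁻¹ * x| ^ s / s ≤ |x| ^ s / 6 := by
    rw [abs_mul, abs_inv, abs_of_pos hc0, mul_rpow (by positivity) (abs_nonneg x),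
      inv_rpow hc0.le, inv_mul_eq_div, div_div]
    gcongr
    nlinarith
  calc exp (l * c⁻¹ * x) ≤ exp (|l| ^ p / 2 + |x| ^ s / 6) := by
        rw [mul_assoc]
        exact exp_le_exp.2 (by linarith)
    _ = exp (|l| ^ p / 2) * exp (|x| ^ s / 6) := exp_add _ _
    _ ≤ _ := by gcongr; exact exp_div_six_le _

/-- Let `s ∈ (1, 2]`. There exists `C(s) < ∞` such that every real random variable `X`
with `X = O_s(1)` (i.e. both `𝔼[exp((max(X,0))^s)] ≤ 2` and `𝔼[exp((max(-X,0))^s)] ≤ 2`)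
and `𝔼[X] = 0` satisfies `X = Ō_s(C)`: for every `λ ∈ ℝ`,
`log 𝔼[exp(λ C⁻¹ X)] ≤ max(λ², |λ|^(s/(s-1)))`. -/
theorem stmt_7 (s : ℝ) (hs1 : 1 < s) (hs2 : s ≤ 2) :
    ∃ C : ℝ, 0 < C ∧
      ∀ (Ω : Type*) [MeasurableSpace Ω] (μ : Measure Ω) [IsProbabilityMeasure μ]
        (X : Ω → ℝ),
        ((∫⁻ ω, ENNReal.ofReal (Real.exp ((max (X ω) 0) ^ s)) ∂μ) ≤ 2 ∧
          (∫⁻ ω, ENNReal.ofReal (Real.exp ((max (-X ω) 0) ^ s)) ∂μ) ≤ 2) →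
        Integrable X μ → (∫ ω, X ω ∂μ) = 0 →
        barO μ s C X := by
  set p := s / (s - 1) with hp_def
  have hps : p.HolderConjugate s := (Real.HolderConjugate.conjExponent hs1).symm
  have hp2 : 2 ≤ p := by
    rw [hp_def, le_div_iff₀ (by linarith)]
    linarith
  set K := 2 * exp ((2 : ℝ) ^ p) with hK
  have hK0 : 0 < K := by positivity
  refine ⟨6 + 4 * K, by positivity, fun Ω _ μ _ X ⟨hpos, hneg⟩ hX hX0 lam => ?_⟩
  obtain ⟨hG, hG4⟩ := integrable_exp_abs_rpow hX.aemeasurable hpos hneg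
  set c := 6 + 4 * K with hc
  have hc6 : 6 ≤ c := by linarith
  rcases le_total |lam| 1 with hlam | hlam
  · have ht : |lam * c⁻¹| ≤ 1 := by
      rw [abs_mul, abs_inv, abs_of_pos (by linarith : 0 < c)]
      exact mul_le_one₀ hlam (by positivity) (inv_le_one_of_one_le₀ (by linarith))
    refine (lintegral_ofReal_le_of_le_affine (fun _ => (exp_pos _).le) hX hX0 hG hG4
      (by positivity) fun ω => exp_mul_le_of_abs_le_one hps ht (X ω)).trans
      (ENNReal.ofReal_le_ofReal ?_)
    have hle : 4 * ((lam * c⁻¹) ^ 2 * K) ≤ lam ^ 2 := by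
      rw [mul_pow, inv_pow, show 4 * (lam ^ 2 * (c ^ 2)⁻¹ * K) = lam ^ 2 * (4 * K / c ^ 2) by ring]
      refine mul_le_of_le_one_right (sq_nonneg _) ((div_le_one₀ (by positivity)).2 ?_)
      nlinarith
    calc 1 + 4 * ((lam * c⁻¹) ^ 2 * K) ≤ lam ^ 2 + 1 := by linarith
      _ ≤ exp (lam ^ 2) := add_one_le_exp _
      _ ≤ _ := exp_le_exp.2 (le_max_left _ _)
  · have hL : 1 ≤ |lam| ^ p := one_le_rpow hlam (by linarith)
    refine (lintegral_ofReal_le_of_le_affine (a := exp (|lam| ^ p / 2) * (5 / 6)) (b := 0)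
      (d := exp (|lam| ^ p / 2) / 6) (fun _ => (exp_pos _).le) hX hX0 hG hG4
      (by positivity) fun ω => (exp_mul_inv_mul_le hps hp2 hc6 lam (X ω)).trans_eq
        (by ring)).trans (ENNReal.ofReal_le_ofReal ?_)
    calc exp (|lam| ^ p / 2) * (5 / 6) + 4 * (exp (|lam| ^ p / 2) / 6)
        = exp (|lam| ^ p / 2) * (1 / 2 + 1) := by ring
      _ ≤ exp (|lam| ^ p / 2) * exp (1 / 2) := by gcongr; exact add_one_le_exp _
      _ = exp (|lam| ^ p / 2 + 1 / 2) := (exp_add _ _).symm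
      _ ≤ _ := exp_le_exp.2 (le_max_of_le_right (by linarith))
end

section
/- Let s ∈ (1,2]. There exists a constant C(s) < ∞ such that the following holds. Let μ be a measure on a measurable space E, let θ : E → (0, ∞) be measurable with 0 < ∫_E θ dμ < ∞, and let (X(x))_{x ∈ E} be a jointly measurable family of real random variables such that X(x) = Ō_s(θ(x)) for every x ∈ E. Then, almost surely, the map x ↦ X(x) is μ-integrable, and ∫_E X dμ = Ō_s(C ∫_E θ dμ). -/
open MeasureTheory

/-- Jensen's inequality for the exponential, with a possibly infinite right-hand side. -/
lemma ofReal_exp_integral_le_lintegral {E : Type*} [MeasurableSpace E] (P : Measure E)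
    [IsProbabilityMeasure P] {f : E → ℝ} (hf : Integrable f P) :
    ENNReal.ofReal (Real.exp (∫ x, f x ∂P)) ≤ ∫⁻ x, ENNReal.ofReal (Real.exp (f x)) ∂P := by
  by_cases h : Integrable (fun x => Real.exp (f x)) P
  · rw [← ofReal_integral_eq_lintegral_ofReal h (ae_of_all _ fun x => (Real.exp_pos _).le)]
    exact ENNReal.ofReal_le_ofReal
      (convexOn_exp.map_integral_le Real.continuous_exp.continuousOn isClosed_univ
        (by simp) hf h)
  · have hm : AEStronglyMeasurable (fun x => Real.exp (f x)) P :=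
      Real.continuous_exp.comp_aestronglyMeasurable hf.1
    have htop : ∫⁻ x, ENNReal.ofReal (Real.exp (f x)) ∂P = ⊤ := by
      by_contra hne
      exact h ((lintegral_ofReal_ne_top_iff_integrable hm
        (ae_of_all _ fun x => (Real.exp_pos _).le)).1 hne)
    rw [htop]
    exact le_top

/-- Exponential moments bounded uniformly in `x` pass to the average over a probability
measure. -/
lemma lintegral_exp_mul_le {Ω E : Type*} [MeasurableSpace Ω] [MeasurableSpace E]
    (μ : Measure Ω) [SFinite μ] (P : Measure E) [IsProbabilityMeasure P] {Y : E → Ω → ℝ}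
    (hY : Measurable (Function.uncurry Y)) {c : ℝ} {K : ENNReal}
    (hK : ∀ x, ∫⁻ ω, ENNReal.ofReal (Real.exp (c * Y x ω)) ∂μ ≤ K) :
    ∫⁻ ω, ∫⁻ x, ENNReal.ofReal (Real.exp (c * Y x ω)) ∂P ∂μ ≤ K := by
  have hm : Measurable (fun p : E × Ω => ENNReal.ofReal (Real.exp (c * Y p.1 p.2))) :=
    (Real.measurable_exp.comp (hY.const_mul c)).ennreal_ofReal
  rw [lintegral_lintegral_swap (f := fun ω x => ENNReal.ofReal (Real.exp (c * Y x ω)))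
    (hm.comp measurable_swap).aemeasurable]
  calc _ ≤ ∫⁻ _, K ∂P := lintegral_mono hK
    _ = K := by simp

/-- A jointly measurable family with uniformly bounded exponential moments of orders `1` and
`-1` is almost surely integrable with respect to a probability measure. -/
lemma ae_integrable_of_lintegral_exp_le {Ω E : Type*} [MeasurableSpace Ω] [MeasurableSpace E]
    (μ : Measure Ω) [SFinite μ] (P : Measure E) [IsProbabilityMeasure P] {Y : E → Ω → ℝ}
    (hY : Measurable (Function.uncurry Y)) {K₁ K₂ : ENNReal} (hK₁ : K₁ ≠ ⊤) (hK₂ : K₂ ≠ ⊤)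
    (h₁ : ∀ x, ∫⁻ ω, ENNReal.ofReal (Real.exp (1 * Y x ω)) ∂μ ≤ K₁)
    (h₂ : ∀ x, ∫⁻ ω, ENNReal.ofReal (Real.exp (-1 * Y x ω)) ∂μ ≤ K₂) :
    ∀ᵐ ω ∂μ, Integrable (fun x => Y x ω) P := by
  have key (c : ℝ) {K : ENNReal} (hK : K ≠ ⊤)
      (h : ∀ x, ∫⁻ ω, ENNReal.ofReal (Real.exp (c * Y x ω)) ∂μ ≤ K) :
      ∀ᵐ ω ∂μ, Integrable (fun x => Real.exp (c * Y x ω)) P := by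
    have hm : Measurable (fun p : E × Ω => Real.exp (c * Y p.1 p.2)) :=
      Real.measurable_exp.comp (hY.const_mul c)
    have hfin := ((lintegral_exp_mul_le μ P hY h).trans_lt hK.lt_top).ne
    filter_upwards [ae_lt_top hm.ennreal_ofReal.lintegral_prod_left' hfin] with ω hω
    exact (lintegral_ofReal_ne_top_iff_integrable
      (hm.comp measurable_prodMk_right).aestronglyMeasurable
      (ae_of_all _ fun x => (Real.exp_pos _).le)).1 hω.ne
  filter_upwards [key 1 hK₁ h₁, key (-1) hK₂ h₂] with ω hp hn
  refine (hp.add hn).mono' (hY.comp measurable_prodMk_right).aestronglyMeasurable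
    (ae_of_all _ fun x => ?_)
  have e₁ := Real.add_one_le_exp (1 * Y x ω)
  have e₂ := Real.add_one_le_exp (-1 * Y x ω)
  have p₁ := Real.exp_pos (1 * Y x ω)
  have p₂ := Real.exp_pos (-1 * Y x ω)
  simp only [Pi.add_apply, Real.norm_eq_abs]
  exact abs_le.2 ⟨by linarith, by linarith⟩

/-- Let `s ∈ (1,2]`. There exists `C(s) < ∞` such that: for every measure `ν` on a
measurable space `E`, every measurable `θ : E → (0,∞)` with `0 < ∫ θ dν < ∞`, and every
jointly measurable family `(X x)_{x ∈ E}` of real random variables with `X x = Ō_s(θ x)`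
for every `x`, almost surely the map `x ↦ X x ω` is `ν`-integrable, and
`∫ X dν = Ō_s(C ∫ θ dν)`. -/
theorem stmt_8 (s : ℝ) (hs1 : 1 < s) (hs2 : s ≤ 2) :
    ∃ C : ℝ, 0 < C ∧
      ∀ (Ω : Type*) [MeasurableSpace Ω] (μ : Measure Ω) [IsProbabilityMeasure μ]
        (E : Type*) [MeasurableSpace E] (ν : Measure E)
        (θ : E → ℝ), Measurable θ → (∀ x, 0 < θ x) → Integrable θ ν →
        (0 < ∫ x, θ x ∂ν) →
        ∀ X : E → Ω → ℝ, Measurable (Function.uncurry X) →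
        (∀ x, barO μ s (θ x) (X x)) →
        (∀ᵐ ω ∂μ, Integrable (fun x => X x ω) ν) ∧
          barO μ s (C * ∫ x, θ x ∂ν) (fun ω => ∫ x, X x ω ∂ν) := by
  refine ⟨1, one_pos, fun Ω _ μ _ E _ ν θ hθm hθ hθi hpos X hX hO => ?_⟩
  set m := ∫ x, θ x ∂ν
  have hd : Measurable (fun x => ENNReal.ofReal (θ x / m)) :=
    (hθm.div_const m).ennreal_ofReal
  let P := ν.withDensity fun x => ENNReal.ofReal (θ x / m)
  have hP : IsProbabilityMeasure P := ⟨by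
    rw [withDensity_apply _ MeasurableSet.univ, setLIntegral_univ,
      ← ofReal_integral_eq_lintegral_ofReal (hθi.div_const m)
        (ae_of_all _ fun x => (div_pos (hθ x) hpos).le),
      integral_div, div_self hpos.ne', ENNReal.ofReal_one]⟩
  let Y : E → Ω → ℝ := fun x ω => (θ x)⁻¹ * X x ω
  have hY : Measurable (Function.uncurry Y) := (hθm.comp measurable_fst).inv.mul hX
  have hYO (lam : ℝ) (x : E) : ∫⁻ ω, ENNReal.ofReal (Real.exp (lam * Y x ω)) ∂μ ≤
      ENNReal.ofReal (Real.exp (max (lam ^ 2) (|lam| ^ (s / (s - 1))))) := by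
    simpa only [Y, mul_assoc] using hO x lam
  have hdY (ω : Ω) : (fun x => (ENNReal.ofReal (θ x / m)).toReal • Y x ω) =
      fun x => m⁻¹ * X x ω := by
    ext x
    have := (hθ x).ne'
    rw [ENNReal.toReal_ofReal (div_pos (hθ x) hpos).le, smul_eq_mul]
    simp only [Y]
    field_simp
  have hYi : ∀ᵐ ω ∂μ, Integrable (fun x => Y x ω) P :=
    ae_integrable_of_lintegral_exp_le μ P hY ENNReal.ofReal_ne_top ENNReal.ofReal_ne_top
      (hYO 1) (hYO (-1))
  refine ⟨?_, fun lam => ?_⟩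
  · filter_upwards [hYi] with ω hω
    rw [integrable_withDensity_iff_integrable_smul' hd (ae_of_all _ fun _ =>
      ENNReal.ofReal_lt_top), hdY] at hω
    simpa [mul_inv_cancel_left₀ hpos.ne'] using hω.const_mul m
  · refine le_trans (lintegral_mono_ae ?_) (lintegral_exp_mul_le μ P hY (hYO lam))
    filter_upwards [hYi] with ω hω
    have hint : ∫ x, Y x ω ∂P = m⁻¹ * ∫ x, X x ω ∂ν := by
      rw [integral_withDensity_eq_integral_toReal_smul hd (ae_of_all _ fun _ =>
        ENNReal.ofReal_lt_top), hdY, integral_const_mul]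
    have hJ := ofReal_exp_integral_le_lintegral P (hω.const_mul lam)
    rwa [integral_const_mul, hint, ← mul_assoc, ← one_mul m] at hJ
end

section
/- There exists a universal constant C < ∞ such that the following holds. Let X be a real random variable with 𝔼[exp(2|X|)] ≤ 2 and 𝔼[X] = 0. Then for every λ₁ ∈ (0,1], X = 𝒩(𝔼[X²], C·λ₁, λ₁); that is, for every λ ∈ ℝ with |λ| < λ₁, |log 𝔼[exp(λ X)] − 𝔼[X²]·λ²/2| ≤ C λ₁ λ². -/
open MeasureTheory

/-- `X = 𝒩(σ², c, λ₁)`: for every `λ ∈ ℝ` with `|λ| < λ₁`,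
`|log 𝔼[exp(λ X)] − σ² λ² / 2| ≤ c λ²`, stated as the equivalent two-sided bound
`exp(σ²λ²/2 − cλ²) ≤ 𝔼[exp(λ X)] ≤ exp(σ²λ²/2 + cλ²)`. -/
def gaussBound {Ω : Type*} [MeasurableSpace Ω] (μ : Measure Ω) (σ2 c lam1 : ℝ)
    (X : Ω → ℝ) : Prop :=
  ∀ lam : ℝ, |lam| < lam1 →
    ENNReal.ofReal (Real.exp (σ2 * lam ^ 2 / 2 - c * lam ^ 2)) ≤
        (∫⁻ ω, ENNReal.ofReal (Real.exp (lam * X ω)) ∂μ) ∧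
      (∫⁻ ω, ENNReal.ofReal (Real.exp (lam * X ω)) ∂μ) ≤
        ENNReal.ofReal (Real.exp (σ2 * lam ^ 2 / 2 + c * lam ^ 2))

/-- Third-order Taylor bound for `exp (t * x)`, uniform in `|t| ≤ 1`. -/
theorem abs_exp_mul_sub_quadratic_le {t : ℝ} (ht : |t| ≤ 1) (x : ℝ) :
    |Real.exp (t * x) - (1 + t * x + t ^ 2 / 2 * x ^ 2)| ≤
      6 * |t| ^ 3 * Real.exp (2 * |x|) := by
  have taylor : |Real.exp (t * x) - (1 + t * x + t ^ 2 / 2 * x ^ 2)| ≤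
      |t * x| ^ 3 * Real.exp |t * x| := by
    have h := Complex.norm_exp_sub_sum_le_norm_mul_exp ((t * x : ℝ) : ℂ) 3
    rw [Complex.norm_real, Real.norm_eq_abs] at h
    refine le_trans (le_of_eq ?_) h
    rw [← Real.norm_eq_abs, ← Complex.norm_real]
    congr 1
    simp only [Finset.sum_range_succ, Finset.sum_range_zero, Nat.factorial]
    push_cast
    ring
  have cube : |x| ^ 3 ≤ 6 * Real.exp |x| := by
    have h := Real.pow_div_factorial_le_exp |x| (abs_nonneg x) 3
    norm_num [Nat.factorial] at h
    linarith
  have mono : Real.exp |t * x| ≤ Real.exp |x| := by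
    rw [Real.exp_le_exp, abs_mul]
    exact mul_le_of_le_one_left (abs_nonneg x) ht
  calc _ ≤ |t * x| ^ 3 * Real.exp |t * x| := taylor
    _ = |t| ^ 3 * (|x| ^ 3 * Real.exp |t * x|) := by rw [abs_mul]; ring
    _ ≤ |t| ^ 3 * ((6 * Real.exp |x|) * Real.exp |x|) := by gcongr
    _ = 6 * |t| ^ 3 * Real.exp (2 * |x|) := by rw [two_mul, Real.exp_add]; ring

/-- Passing from a cubic approximation of a moment generating function to a two-sided
exponential bound. -/
theorem exp_bounds_of_abs_sub_quadratic_le {M s t r : ℝ} (hs1 : s ≤ 1)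
    (htr : |t| ≤ r) (hr : r ≤ 1) (hM1 : 1 ≤ M)
    (hM : |M - (1 + s * t ^ 2 / 2)| ≤ 12 * |t| ^ 3) :
    Real.exp (s * t ^ 2 / 2 - 13 * r * t ^ 2) ≤ M ∧
      M ≤ Real.exp (s * t ^ 2 / 2 + 13 * r * t ^ 2) := by
  have ht0 := abs_nonneg t
  have ht2 : t ^ 2 ≤ r := by rw [← sq_abs]; nlinarith
  have ht3 : |t| ^ 3 ≤ r * t ^ 2 := by
    rw [← sq_abs t, pow_succ' |t| 2]; gcongr
  have hrt : 0 ≤ r * t ^ 2 := mul_nonneg (ht0.trans htr) (sq_nonneg t)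
  obtain ⟨hlo, hhi⟩ := abs_le.mp hM
  constructor
  · rcases le_total (s * t ^ 2 / 2 - 13 * r * t ^ 2) 0 with hu | hu
    · exact (Real.exp_le_one_iff.mpr hu).trans hM1
    · set u := s * t ^ 2 / 2 - 13 * r * t ^ 2 with hudef
      have hut : u ≤ t ^ 2 := by nlinarith [sq_nonneg t]
      have hexp := (abs_le.mp (Real.abs_exp_sub_one_sub_id_le (x := u)
        (by rw [abs_of_nonneg hu]; linarith))).2
      have husq : u ^ 2 ≤ r * t ^ 2 := by
        nlinarith [mul_le_mul hut hut hu (sq_nonneg t),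
          mul_le_mul_of_nonneg_right ht2 (sq_nonneg t)]
      linarith
  · linarith [Real.add_one_le_exp (s * t ^ 2 / 2 + 13 * r * t ^ 2)]

/-- There exists a universal constant `C < ∞` such that: if `X` is a real random variable
with `𝔼[exp(2|X|)] ≤ 2` and `𝔼[X] = 0`, then for every `λ₁ ∈ (0,1]`,
`X = 𝒩(𝔼[X²], C λ₁, λ₁)`. -/
theorem stmt_12 :
    ∃ C : ℝ, 0 < C ∧
      ∀ (Ω : Type*) [MeasurableSpace Ω] (μ : Measure Ω) [IsProbabilityMeasure μ]
        (X : Ω → ℝ),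
        (∫⁻ ω, ENNReal.ofReal (Real.exp (2 * |X ω|)) ∂μ) ≤ 2 →
        Integrable X μ → (∫ ω, X ω ∂μ) = 0 →
        ∀ lam₁ : ℝ, 0 < lam₁ → lam₁ ≤ 1 →
          gaussBound μ (∫ ω, (X ω) ^ 2 ∂μ) (C * lam₁) lam₁ X := by
  refine ⟨13, by norm_num, ?_⟩
  intro Ω _ μ _ X hexp hX hmean r hr hr1 t ht
  have ht1 : |t| ≤ 1 := ht.le.trans hr1
  have hXm := hX.aestronglyMeasurable
  have hEm : AEStronglyMeasurable (fun ω => Real.exp (2 * |X ω|)) μ :=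
    Real.continuous_exp.comp_aestronglyMeasurable (hXm.norm.const_mul 2)
  have hE : Integrable (fun ω => Real.exp (2 * |X ω|)) μ := by
    rw [← lintegral_ofReal_ne_top_iff_integrable hEm (ae_of_all _ fun ω => (Real.exp_pos _).le)]
    exact ne_top_of_le_ne_top (by norm_num) hexp
  have hE2 : ∫ ω, Real.exp (2 * |X ω|) ∂μ ≤ 2 := by
    rw [← ofReal_integral_eq_lintegral_ofReal hE (ae_of_all _ fun ω => (Real.exp_pos _).le)]
      at hexp
    exact (ENNReal.ofReal_le_ofReal_iff (by norm_num)).mp (by simpa using hexp)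
  have hsq_le (ω : Ω) : 2 * X ω ^ 2 ≤ Real.exp (2 * |X ω|) := by
    have h := Real.pow_div_factorial_le_exp (2 * |X ω|) (by positivity) 2
    rw [mul_pow, sq_abs] at h
    norm_num [Nat.factorial] at h
    linarith
  have hT : Integrable (fun ω => Real.exp (t * X ω)) μ := by
    refine hE.mono' (Real.continuous_exp.comp_aestronglyMeasurable (hXm.const_mul t))
      (ae_of_all _ fun ω => ?_)
    rw [Real.norm_eq_abs, Real.abs_exp, Real.exp_le_exp]
    have h := mul_le_mul_of_nonneg_right ht1 (abs_nonneg (X ω))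
    linarith [le_abs_self (t * X ω), abs_mul t (X ω), abs_nonneg (X ω)]
  have hS : Integrable (fun ω => X ω ^ 2) μ := by
    refine hE.mono' (hXm.pow 2) (ae_of_all _ fun ω => ?_)
    rw [Real.norm_eq_abs, abs_of_nonneg (sq_nonneg _)]
    linarith [hsq_le ω, sq_nonneg (X ω)]
  have hs1 : ∫ ω, X ω ^ 2 ∂μ ≤ 1 := by
    have h := integral_mono (hS.const_mul 2) hE hsq_le
    rw [integral_const_mul] at h
    linarith
  have hlin : Integrable (fun ω => 1 + t * X ω) μ := (integrable_const 1).add (hX.const_mul t)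
  have hlin_eq : ∫ ω, (1 + t * X ω) ∂μ = 1 := by
    rw [integral_add (integrable_const 1) (hX.const_mul t), integral_const_mul, hmean]
    simp
  have hquad : Integrable (fun ω => 1 + t * X ω + t ^ 2 / 2 * X ω ^ 2) μ :=
    hlin.add (hS.const_mul _)
  have hM1 : 1 ≤ ∫ ω, Real.exp (t * X ω) ∂μ := by
    have h := integral_mono hlin hT fun ω => by
      linarith [Real.add_one_le_exp (t * X ω)]
    rwa [hlin_eq] at h
  have hM : |(∫ ω, Real.exp (t * X ω) ∂μ) - (1 + (∫ ω, X ω ^ 2 ∂μ) * t ^ 2 / 2)| ≤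
      12 * |t| ^ 3 := by
    have hq : ∫ ω, (1 + t * X ω + t ^ 2 / 2 * X ω ^ 2) ∂μ =
        1 + (∫ ω, X ω ^ 2 ∂μ) * t ^ 2 / 2 := by
      rw [integral_add hlin (hS.const_mul _), hlin_eq, integral_const_mul]
      ring
    rw [← hq, ← integral_sub hT hquad, ← Real.norm_eq_abs]
    calc _ ≤ ∫ ω, 6 * |t| ^ 3 * Real.exp (2 * |X ω|) ∂μ :=
          norm_integral_le_of_norm_le (hE.const_mul _)
            (ae_of_all _ fun ω => abs_exp_mul_sub_quadratic_le ht1 (X ω))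
      _ = 6 * |t| ^ 3 * ∫ ω, Real.exp (2 * |X ω|) ∂μ := integral_const_mul _ _
      _ ≤ 6 * |t| ^ 3 * 2 := by gcongr
      _ = 12 * |t| ^ 3 := by ring
  rw [← ofReal_integral_eq_lintegral_ofReal hT (ae_of_all _ fun ω => (Real.exp_pos _).le)]
  obtain ⟨hlo, hhi⟩ := exp_bounds_of_abs_sub_quadratic_le hs1 ht.le hr1 hM1 hM
  exact ⟨ENNReal.ofReal_le_ofReal hlo, ENNReal.ofReal_le_ofReal hhi⟩
end

section
/- Let d ≥ 1 be an integer and Λ ≥ 1. There exists a constant C(d, Λ) < ∞ such that the following holds for every real symmetric d×d matrix ā all of whose eigenvalues lie in [1, Λ] and every R > 0. Set Ψ_R(x) := R^{−d} exp(−|x|/R). Let w : ℝ^d × [0, ∞) → ℝ be continuous, smooth on ℝ^d × (0, ∞), and solve the constant-coefficient parabolic equation ∂_t w(x,t) = Σ_{i,j=1}^d ā_{ij} ∂_{x_i}∂_{x_j} w(x,t) for all (x,t) ∈ ℝ^d × (0, ∞). Assume that w and its spatial gradient ∇w grow at most polynomially in x, locally uniformly for t in compact subsets of (0, R²], and that ∫_{ℝ^d}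 |w(y,0)|² Ψ_R(y) dy < ∞ and ∫₀^{R²} ∫_{ℝ^d} (|w(y,t)|² + |∇w(y,t)|²) Ψ_R(y) dy dt < ∞. Then for every σ ∈ (0,1]: ∫_{ℝ^d} |w(y,0)|² Ψ_R(y) dy ≤ C ∫_{ℝ^d} |w(y, (σR)²)|² Ψ_R(y) dy + C ∫₀^{(σR)²} ∫_{ℝ^d} |∇w(y,t)|² Ψ_R(y) dy dt. -/
open MeasureTheory Matrix

/-- The spatial partial derivative `∂_i f(x)`. -/
noncomputable def pd (d : ℕ) (f : (Fin d → ℝ) → ℝ) (i : Fin d) (x : Fin d → ℝ) : ℝ :=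
  fderiv ℝ f x (Pi.single i 1)


lemma ofReal_integral_le_lintegral_ofReal {α : Type*} [MeasurableSpace α] {μ : Measure α}
    (f : α → ℝ) : ENNReal.ofReal (∫ x, f x ∂μ) ≤ ∫⁻ x, ENNReal.ofReal (f x) ∂μ := by
  by_cases hf : Integrable f μ
  · rw [integral_eq_lintegral_pos_part_sub_lintegral_neg_part hf]
    refine (ENNReal.ofReal_le_ofReal (sub_le_self _ ENNReal.toReal_nonneg)).trans ?_
    exact ENNReal.ofReal_toReal_le
  · simp [integral_undef hf]

lemma two_mul_bilin_le {d : ℕ} {A : Matrix (Fin d) (Fin d) ℝ} {Λ : ℝ} (hA : A.IsSymm)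
    (hell : ∀ ξ : Fin d → ℝ,
      (∑ i, ξ i ^ 2) ≤ ξ ⬝ᵥ A.mulVec ξ ∧ ξ ⬝ᵥ A.mulVec ξ ≤ Λ * ∑ i, ξ i ^ 2)
    (x y : Fin d → ℝ) :
    2 * (x ⬝ᵥ A.mulVec y) ≤ Λ * (∑ i, x i ^ 2) + Λ * ∑ i, y i ^ 2 := by
  have hsymm : y ⬝ᵥ A.mulVec x = x ⬝ᵥ A.mulVec y := by
    rw [dotProduct_mulVec, ← mulVec_transpose, hA.eq, dotProduct_comm]
  have h : 0 ≤ (x - y) ⬝ᵥ A.mulVec (x - y) :=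
    (Finset.sum_nonneg fun i _ => sq_nonneg ((x - y) i)).trans (hell _).1
  rw [mulVec_sub, sub_dotProduct, dotProduct_sub, dotProduct_sub, hsymm] at h
  linarith [(hell x).2, (hell y).2]

lemma flux_le {d : ℕ} {A : Matrix (Fin d) (Fin d) ℝ} {Λ : ℝ} (hΛ : 0 ≤ Λ) (hA : A.IsSymm)
    (hell : ∀ ξ : Fin d → ℝ,
      (∑ i, ξ i ^ 2) ≤ ξ ⬝ᵥ A.mulVec ξ ∧ ξ ⬝ᵥ A.mulVec ξ ≤ Λ * ∑ i, ξ i ^ 2)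
    {χ φ ε r M : ℝ} (hχ₀ : 0 ≤ χ) (hχ₁ : χ ≤ 1) (hφ : 0 ≤ φ) (hε : 0 ≤ ε) (hM : 0 ≤ M)
    (u : ℝ) (g a b : Fin d → ℝ) (ha : ∑ i, a i ^ 2 ≤ r) (hb : ∑ i, b i ^ 2 ≤ M) :
    2 * ∑ i, ∑ j, A i j * (g j * (g i * (χ * φ) + u * (χ * (φ * a i) + ε * b i * φ))) ≤
      Λ * r * (u ^ 2 * (χ * φ)) +
        (3 * Λ * (∑ i, g i ^ 2) + ε * (Λ * (1 + M)) * (u ^ 2 + ∑ i, g i ^ 2)) * φ := by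
  have hexp : ∑ i, ∑ j, A i j * (g j * (g i * (χ * φ) + u * (χ * (φ * a i) + ε * b i * φ))) =
      (χ * φ) * (g ⬝ᵥ A.mulVec g) + (χ * φ) * ((u • a) ⬝ᵥ A.mulVec g) +
        (ε * φ) * ((u • b) ⬝ᵥ A.mulVec g) := by
    simp only [dotProduct, mulVec, Finset.mul_sum, ← Finset.sum_add_distrib, Pi.smul_apply,
      smul_eq_mul]
    refine Finset.sum_congr rfl fun i _ => Finset.sum_congr rfl fun j _ => ?_
    ring
  have hsq : ∀ v : Fin d → ℝ, ∑ i, (u • v) i ^ 2 = u ^ 2 * ∑ i, v i ^ 2 := fun v => by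
    simp [mul_pow, Finset.mul_sum]
  have h₁ := (hell g).2
  have h₂ := two_mul_bilin_le hA hell (u • a) g
  have h₃ := two_mul_bilin_le hA hell (u • b) g
  rw [hsq] at h₂ h₃
  have hG : 0 ≤ ∑ i, g i ^ 2 := Finset.sum_nonneg fun i _ => sq_nonneg (g i)
  rw [hexp]
  set G := ∑ i, g i ^ 2
  have hua : Λ * (u ^ 2 * ∑ i, a i ^ 2) ≤ Λ * (u ^ 2 * r) := by gcongr
  have hub : Λ * (u ^ 2 * ∑ i, b i ^ 2) ≤ Λ * (u ^ 2 * M) := by gcongr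
  have h₄ : (χ * φ) * (2 * (g ⬝ᵥ A.mulVec g) + 2 * ((u • a) ⬝ᵥ A.mulVec g)) ≤
      (χ * φ) * (Λ * (u ^ 2 * r) + 3 * Λ * G) := by
    exact mul_le_mul_of_nonneg_left (by linarith) (by positivity)
  have h₅ : (ε * φ) * (2 * ((u • b) ⬝ᵥ A.mulVec g)) ≤
      (ε * φ) * ((Λ * (1 + M)) * (u ^ 2 + G)) := by
    have : 0 ≤ Λ * u ^ 2 := by positivity
    have : 0 ≤ Λ * M * G := by positivity
    exact mul_le_mul_of_nonneg_left (by linarith) (by positivity)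
  have h₆ : χ * (φ * (3 * Λ * G)) ≤ 1 * (φ * (3 * Λ * G)) := by gcongr
  linarith

lemma pd_mul {d : ℕ} {f g : (Fin d → ℝ) → ℝ} {x : Fin d → ℝ} (hf : DifferentiableAt ℝ f x)
    (hg : DifferentiableAt ℝ g x) (i : Fin d) :
    pd d (fun y => f y * g y) i x = f x * pd d g i x + pd d f i x * g x := by
  simp [pd, fderiv_fun_mul hf hg, mul_comm]

lemma contDiff_pd {d : ℕ} {f : (Fin d → ℝ) → ℝ} (hf : ContDiff ℝ (⊤ : ℕ∞) f) (i : Fin d) :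
    ContDiff ℝ (⊤ : ℕ∞) (pd d f i) :=
  (hf.fderiv_right (by simp)).clm_apply contDiff_const

lemma integral_mul_elliptic_eq {d : ℕ} (A : Matrix (Fin d) (Fin d) ℝ)
    {u η : (Fin d → ℝ) → ℝ} (hu : ContDiff ℝ (⊤ : ℕ∞) u) (hη : ContDiff ℝ (⊤ : ℕ∞) η)
    (hηc : HasCompactSupport η) :
    ∫ x, u x * η x * ∑ i, ∑ j, A i j * pd d (fun y => pd d u j y) i x =
      -∫ x, ∑ i, ∑ j, A i j * (pd d u j x * (pd d u i x * η x + u x * pd d η i x)) := by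
  have huη : ContDiff ℝ (⊤ : ℕ∞) (fun x => u x * η x) := hu.mul hη
  have hc : HasCompactSupport (fun x => u x * η x) := hηc.mul_left
  have hc' : ∀ i, HasCompactSupport (pd d (fun x => u x * η x) i) := fun i =>
    hc.fderiv_apply (𝕜 := ℝ) (Pi.single i 1)
  have hpd : ∀ i x, pd d u i x * η x + u x * pd d η i x = pd d (fun x => u x * η x) i x :=
    fun i x => by
      rw [pd_mul (hu.differentiable (by simp) x) (hη.differentiable (by simp) x), add_comm]
  have hint₁ : ∀ i j, Integrable (fun x => u x * η x * pd d (pd d u j) i x) := fun i j =>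
    (huη.continuous.mul (contDiff_pd (contDiff_pd hu j) i).continuous).integrable_of_hasCompactSupport hc.mul_right
  have hint₂ : ∀ i j, Integrable (fun x => pd d (fun x => u x * η x) i x * pd d u j x) :=
    fun i j => ((contDiff_pd huη i).continuous.mul (contDiff_pd hu j).continuous).integrable_of_hasCompactSupport
      (hc' i).mul_right
  have hibp : ∀ i j, ∫ x, u x * η x * pd d (pd d u j) i x =
      -∫ x, pd d (fun x => u x * η x) i x * pd d u j x := fun i j =>
    integral_mul_fderiv_eq_neg_fderiv_mul_of_integrable (hint₂ i j) (hint₁ i j)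
      ((huη.continuous.mul (contDiff_pd hu j).continuous).integrable_of_hasCompactSupport hc.mul_right)
      (fun x _ => huη.differentiable (by simp) x)
      (fun x _ => (contDiff_pd hu j).differentiable (by simp) x)
  have hsum : ∀ F : Fin d → Fin d → (Fin d → ℝ) → ℝ, (∀ i j, Integrable (F i j)) →
      ∫ x, ∑ i, ∑ j, A i j * F i j x = ∑ i, ∑ j, A i j * ∫ x, F i j x := fun F hF => by
    refine (integral_finsetSum _ fun i _ => integrable_finsetSum _ fun j _ =>
      (hF i j).const_mul _).trans (Finset.sum_congr rfl fun i _ => ?_)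
    refine (integral_finsetSum _ fun j _ => (hF i j).const_mul _).trans
      (Finset.sum_congr rfl fun j _ => ?_)
    exact integral_const_mul _ _
  have e₁ : ∀ x, u x * η x * ∑ i, ∑ j, A i j * pd d (fun y => pd d u j y) i x =
      ∑ i, ∑ j, A i j * (u x * η x * pd d (pd d u j) i x) := fun x => by
    simp only [Finset.mul_sum]
    refine Finset.sum_congr rfl fun i _ => Finset.sum_congr rfl fun j _ => ?_
    ring
  have e₂ : ∀ i j x, A i j * (pd d u j x * pd d (fun x => u x * η x) i x) =
      A i j * (pd d (fun x => u x * η x) i x * pd d u j x) := fun i j x => by ring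
  simp only [e₁, hpd, e₂]
  rw [hsum _ hint₁, hsum _ hint₂, ← Finset.sum_neg_distrib]
  refine Finset.sum_congr rfl fun i _ => ?_
  rw [← Finset.sum_neg_distrib]
  refine Finset.sum_congr rfl fun j _ => ?_
  rw [hibp, mul_neg]

lemma exists_smooth_exp_weight (d : ℕ) {R : ℝ} (hR : 0 < R) :
    ∃ (Φ : (Fin d → ℝ) → ℝ) (a : (Fin d → ℝ) → Fin d → ℝ), ContDiff ℝ (⊤ : ℕ∞) Φ ∧
      (∀ x, 0 ≤ Φ x) ∧
      (∀ x, Φ x ≤ Real.exp (-Real.sqrt (∑ i, x i ^ 2) / R) / R ^ d) ∧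
      (∀ x, Real.exp (-Real.sqrt (∑ i, x i ^ 2) / R) / R ^ d ≤ Real.exp 1 * Φ x) ∧
      (∀ x i, pd d Φ i x = Φ x * a x i) ∧ ∀ x, ∑ i, a x i ^ 2 ≤ 1 / R ^ 2 := by
  have hpos : ∀ x : Fin d → ℝ, 0 < R ^ 2 + ∑ i, x i ^ 2 := fun x => by positivity
  refine ⟨fun x => Real.exp (-Real.sqrt (R ^ 2 + ∑ i, x i ^ 2) / R) / R ^ d,
    fun x i => -(x i / Real.sqrt (R ^ 2 + ∑ i, x i ^ 2)) / R, ?_, fun x => by positivity,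
    fun x => ?_, fun x => ?_, fun x i => ?_, fun x => ?_⟩
  · have h : ContDiff ℝ (⊤ : ℕ∞) fun x : Fin d → ℝ => Real.sqrt (R ^ 2 + ∑ i, x i ^ 2) :=
      ContDiff.sqrt (by fun_prop) fun x => (hpos x).ne'
    fun_prop
  · beta_reduce
    gcongr
    exact le_add_of_nonneg_left (by positivity)
  · beta_reduce
    rw [← mul_div_assoc, ← Real.exp_add]
    gcongr
    have : Real.sqrt (R ^ 2 + ∑ i, x i ^ 2) ≤ R + Real.sqrt (∑ i, x i ^ 2) := by
      rw [Real.sqrt_le_left (by positivity)]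
      have h := Real.sq_sqrt (show 0 ≤ ∑ i, x i ^ 2 by positivity)
      have : 0 ≤ R * Real.sqrt (∑ i, x i ^ 2) := by positivity
      nlinarith
    rw [div_le_iff₀ hR, add_mul, div_mul_cancel₀ _ hR.ne']
    linarith
  · have h₁ : HasFDerivAt (fun x : Fin d → ℝ => R ^ 2 + ∑ i, x i ^ 2)
        (∑ j, (2 * x j) • (ContinuousLinearMap.proj j : (Fin d → ℝ) →L[ℝ] ℝ)) x := by
      have h : ∀ j, HasFDerivAt (fun x : Fin d → ℝ => x j ^ 2)
          ((2 * x j) • (ContinuousLinearMap.proj j : (Fin d → ℝ) →L[ℝ] ℝ)) x := fun j => by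
        simpa using (ContinuousLinearMap.proj j : (Fin d → ℝ) →L[ℝ] ℝ).hasFDerivAt.pow 2
      exact (HasFDerivAt.fun_sum fun j _ => h j).const_add _
    have h₂ := ((((h₁.sqrt (hpos x).ne').fun_neg).mul_const (R⁻¹)).exp).mul_const ((R ^ d)⁻¹)
    have h₃ := h₂.fderiv
    simp only [← div_eq_mul_inv] at h₃
    rw [pd, h₃]
    simp [Pi.single_apply]
    field_simp
  · have hs := Real.sq_sqrt (hpos x).le
    simp only [div_pow, neg_sq]
    rw [← Finset.sum_div, ← Finset.sum_div, hs]
    gcongr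
    rw [div_le_one (hpos x)]
    exact le_add_of_nonneg_left (by positivity)

lemma exists_smooth_cutoff (d : ℕ) :
    ∃ (θ : (Fin d → ℝ) → ℝ) (M : ℝ), ContDiff ℝ (⊤ : ℕ∞) θ ∧ HasCompactSupport θ ∧
      (∀ x, 0 ≤ θ x) ∧ (∀ x, θ x ≤ 1) ∧ θ 0 = 1 ∧ 0 ≤ M ∧ ∀ x, ∑ i, pd d θ i x ^ 2 ≤ M := by
  let f : ContDiffBump (0 : Fin d → ℝ) := ⟨1, 2, one_pos, one_lt_two⟩
  have hc : ContDiff ℝ (⊤ : ℕ∞) f := f.contDiff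
  have hk : ∀ i, ∃ C, ∀ x, ‖pd d f i x‖ ≤ C := fun i =>
    (f.hasCompactSupport.fderiv_apply (𝕜 := ℝ) (Pi.single i 1)).exists_bound_of_continuous
      (contDiff_pd hc i).continuous
  choose C hC using hk
  refine ⟨f, ∑ i, C i ^ 2, hc, f.hasCompactSupport, fun x => f.nonneg, fun x => f.le_one,
    f.one_of_mem_closedBall (by simp [f]), by positivity, fun x => ?_⟩
  refine Finset.sum_le_sum fun i _ => ?_
  rw [← sq_abs]
  exact pow_le_pow_left₀ (abs_nonneg _) (hC i x) 2

lemma pd_comp_smul {d : ℕ} (θ : (Fin d → ℝ) → ℝ) (ε : ℝ) (i : Fin d)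
    (x : Fin d → ℝ) : pd d (fun y => θ (ε • y)) i x = ε * pd d θ i (ε • x) := by
  simp [pd, fderiv_comp_smul]

section SpaceTime

variable {d : ℕ} {w : (Fin d → ℝ) → ℝ → ℝ}

lemma isOpen_pos_time : IsOpen {p : (Fin d → ℝ) × ℝ | 0 < p.2} :=
  isOpen_lt continuous_const continuous_snd

lemma contDiff_slice
    (hw : ContDiffOn ℝ (⊤ : ℕ∞) (fun p : (Fin d → ℝ) × ℝ => w p.1 p.2) {p | 0 < p.2})
    {t : ℝ} (ht : 0 < t) : ContDiff ℝ (⊤ : ℕ∞) (fun z => w z t) :=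
  contDiffOn_univ.1 <| hw.comp (g := fun p : (Fin d → ℝ) × ℝ => w p.1 p.2)
    (f := fun z : Fin d → ℝ => (z, t)) (by fun_prop) fun _ _ => ht

lemma hasFDerivAt_of_pos_time
    (hw : ContDiffOn ℝ (⊤ : ℕ∞) (fun p : (Fin d → ℝ) × ℝ => w p.1 p.2) {p | 0 < p.2})
    (x : Fin d → ℝ) {t : ℝ} (ht : 0 < t) :
    HasFDerivAt (fun p : (Fin d → ℝ) × ℝ => w p.1 p.2)
      (fderiv ℝ (fun p : (Fin d → ℝ) × ℝ => w p.1 p.2) (x, t)) (x, t) :=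
  ((hw.differentiableOn (by simp)).differentiableAt
    (isOpen_pos_time.mem_nhds (show (x, t) ∈ _ from ht))).hasFDerivAt

lemma pd_slice_eq
    (hw : ContDiffOn ℝ (⊤ : ℕ∞) (fun p : (Fin d → ℝ) × ℝ => w p.1 p.2) {p | 0 < p.2})
    (x : Fin d → ℝ) {t : ℝ} (ht : 0 < t) (i : Fin d) :
    pd d (fun z => w z t) i x =
      fderiv ℝ (fun p : (Fin d → ℝ) × ℝ => w p.1 p.2) (x, t) (Pi.single i 1, 0) := by
  have h := HasFDerivAt.comp (f := fun z : Fin d → ℝ => (z, t)) x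
    (hasFDerivAt_of_pos_time hw x ht) (hasFDerivAt_prodMk_left x t)
  have h' : fderiv ℝ (fun z => w z t) x = _ := h.fderiv
  rw [pd, h']
  simp

lemma hasDerivAt_time
    (hw : ContDiffOn ℝ (⊤ : ℕ∞) (fun p : (Fin d → ℝ) × ℝ => w p.1 p.2) {p | 0 < p.2})
    (x : Fin d → ℝ) {t : ℝ} (ht : 0 < t) :
    HasDerivAt (fun τ => w x τ)
      (fderiv ℝ (fun p : (Fin d → ℝ) × ℝ => w p.1 p.2) (x, t) (0, 1)) t := by
  have h := (hasFDerivAt_of_pos_time hw x ht).comp_hasDerivAt t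
    ((hasDerivAt_const t x).prodMk (hasDerivAt_id t))
  exact h

lemma continuousOn_fderiv_apply
    (hw : ContDiffOn ℝ (⊤ : ℕ∞) (fun p : (Fin d → ℝ) × ℝ => w p.1 p.2) {p | 0 < p.2})
    (v : (Fin d → ℝ) × ℝ) :
    ContinuousOn (fun p => fderiv ℝ (fun p : (Fin d → ℝ) × ℝ => w p.1 p.2) p v) {p | 0 < p.2} :=
  (hw.continuousOn_fderiv_of_isOpen isOpen_pos_time (by simp)).clm_apply continuousOn_const

lemma continuousOn_pd
    (hw : ContDiffOn ℝ (⊤ : ℕ∞) (fun p : (Fin d → ℝ) × ℝ => w p.1 p.2) {p | 0 < p.2})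
    (i : Fin d) :
    ContinuousOn (fun p : (Fin d → ℝ) × ℝ => pd d (fun z => w z p.2) i p.1) {p | 0 < p.2} :=
  (continuousOn_fderiv_apply hw (Pi.single i 1, 0)).congr fun p hp => pd_slice_eq hw p.1 hp i

lemma continuousOn_deriv_time
    (hw : ContDiffOn ℝ (⊤ : ℕ∞) (fun p : (Fin d → ℝ) × ℝ => w p.1 p.2) {p | 0 < p.2}) :
    ContinuousOn (fun p : (Fin d → ℝ) × ℝ => deriv (fun τ => w p.1 τ) p.2) {p | 0 < p.2} :=
  (continuousOn_fderiv_apply hw (0, 1)).congr fun p hp => (hasDerivAt_time hw p.1 hp).deriv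

lemma aemeasurable_lintegral_of_continuousOn {f : (Fin d → ℝ) → ℝ → ℝ}
    (hf : ContinuousOn (fun p : (Fin d → ℝ) × ℝ => f p.1 p.2) {p | 0 < p.2}) {s T : ℝ}
    (hs : 0 ≤ s) :
    AEMeasurable (fun t => ∫⁻ y, ENNReal.ofReal (f y t)) (volume.restrict (Set.Ioc s T)) := by
  classical
  have hm := hf.measurable_piecewise (g := fun _ => (0 : ℝ)) continuousOn_const
    isOpen_pos_time.measurableSet
  refine ⟨_, hm.ennreal_ofReal.lintegral_prod_left' (μ := volume), ?_⟩
  filter_upwards [ae_restrict_mem measurableSet_Ioc] with t ht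
  have ht' : 0 < t := hs.trans_lt ht.1
  simp [Set.piecewise, ht']

/-- A backward energy inequality for a compactly supported weight `η`. -/
lemma ofReal_weighted_energy_le {A : Matrix (Fin d) (Fin d) ℝ}
    (hw : ContDiffOn ℝ (⊤ : ℕ∞) (fun p : (Fin d → ℝ) × ℝ => w p.1 p.2) {p | 0 < p.2})
    (heq : ∀ x : Fin d → ℝ, ∀ t : ℝ, 0 < t → deriv (fun τ => w x τ) t =
      ∑ i, ∑ j, A i j * pd d (fun y => pd d (fun z => w z t) j y) i x)
    {η : (Fin d → ℝ) → ℝ} (hη : ContDiff ℝ (⊤ : ℕ∞) η) (hηc : HasCompactSupport η)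
    {s T K : ℝ} (hs : 0 < s) (hsT : s ≤ T) {H : (Fin d → ℝ) → ℝ → ℝ}
    (hH : ∀ t ∈ Set.Ioc s T, ∀ y, Real.exp (K * t) *
      (2 * ∑ i, ∑ j, A i j * (pd d (fun z => w z t) j y *
        (pd d (fun z => w z t) i y * η y + w y t * pd d η i y)) - K * (w y t ^ 2 * η y)) ≤ H y t) :
    ENNReal.ofReal (∫ y, Real.exp (K * s) * (w y s ^ 2 * η y)) ≤
      ENNReal.ofReal (∫ y, Real.exp (K * T) * (w y T ^ 2 * η y)) +
        ∫⁻ t in Set.Ioc s T, ∫⁻ y, ENNReal.ofReal (H y t) := by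
  have hpos : ∀ {t}, t ∈ Set.Icc s T → 0 < t := fun ht => hs.trans_le ht.1
  set P : (Fin d → ℝ) → ℝ → ℝ := fun y t =>
    Real.exp (K * t) * (K * (w y t ^ 2 * η y) + 2 * (w y t * η y * deriv (fun τ => w y τ) t))
    with hP
  have hPc : ContinuousOn (fun p : (Fin d → ℝ) × ℝ => P p.1 p.2) {p | 0 < p.2} := by
    have h₁ := hw.continuousOn
    have h₂ := continuousOn_deriv_time hw
    have h₃ : ContinuousOn (fun p : (Fin d → ℝ) × ℝ => η p.1) {p | 0 < p.2} :=
      (hη.continuous.comp continuous_fst).continuousOn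
    have h₄ : ContinuousOn (fun p : (Fin d → ℝ) × ℝ => Real.exp (K * p.2)) {p | 0 < p.2} := by
      fun_prop
    exact h₄.mul ((continuousOn_const.mul ((h₁.pow 2).mul h₃)).add
      (continuousOn_const.mul ((h₁.mul h₃).mul h₂)))
  have hF : ∀ y, ∀ t ∈ Set.Icc s T,
      HasDerivAt (fun t => Real.exp (K * t) * (w y t ^ 2 * η y)) (P y t) t := fun y t ht => by
    have h := hasDerivAt_time hw y (hpos ht)
    rw [← h.deriv] at h
    have he : HasDerivAt (fun t => Real.exp (K * t)) (Real.exp (K * t) * (K * 1)) t :=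
      ((hasDerivAt_id t).const_mul K).exp
    refine (he.mul ((h.fun_pow 2).mul_const (η y))).congr_deriv ?_
    simp only [hP, Nat.cast_ofNat, Nat.add_one_sub_one, pow_one]
    ring
  have hPs : ∀ y, ContinuousOn (P y) (Set.Icc s T) := fun y =>
    hPc.comp (f := fun t => (y, t)) (by fun_prop) fun t ht => hpos ht
  have hftc : ∀ y, ∫ t in Set.Ioc s T, P y t =
      Real.exp (K * T) * (w y T ^ 2 * η y) - Real.exp (K * s) * (w y s ^ 2 * η y) := fun y => by
    rw [← intervalIntegral.integral_of_le hsT]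
    refine intervalIntegral.integral_eq_sub_of_hasDerivAt
      (f := fun t => Real.exp (K * t) * (w y t ^ 2 * η y)) (fun t ht => hF y t ?_) ?_
    · rwa [Set.uIcc_of_le hsT] at ht
    · exact (hPs y).intervalIntegrable_of_Icc hsT
  have hint : ∀ t, 0 < t → Integrable fun y => Real.exp (K * t) * (w y t ^ 2 * η y) := fun t ht =>
    Continuous.integrable_of_hasCompactSupport
      (continuous_const.mul (((contDiff_slice hw ht).continuous.pow 2).mul hη.continuous))
      hηc.mul_left.mul_left
  have hPint : Integrable (Function.uncurry P) (volume.prod (volume.restrict (Set.Ioc s T))) := by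
    have hK : IsCompact (tsupport η ×ˢ Set.Icc s T) := hηc.isCompact.prod isCompact_Icc
    have h₁ : IntegrableOn (Function.uncurry P) (tsupport η ×ˢ Set.Icc s T)
        (volume.prod volume) :=
      (hPc.mono fun p hp => hpos hp.2).integrableOn_compact hK
    have h₂ : IntegrableOn (Function.uncurry P) (Set.univ ×ˢ Set.Ioc s T)
        (volume.prod volume) :=
      h₁.of_forall_sdiff_eq_zero (MeasurableSet.univ.prod measurableSet_Ioc) fun p hp => by
        have : η p.1 = 0 := image_eq_zero_of_notMem_tsupport fun h =>
          hp.2 ⟨h, Set.Ioc_subset_Icc_self hp.1.2⟩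
        simp [hP, Function.uncurry, this]
    rwa [IntegrableOn, ← Measure.prod_restrict, Measure.restrict_univ] at h₂
  have hswap := integral_integral_swap hPint
  simp only [hftc] at hswap
  rw [integral_sub (hint T (hs.trans_le hsT)) (hint s hs)] at hswap
  have hkey : ∫ y, Real.exp (K * s) * (w y s ^ 2 * η y) =
      (∫ y, Real.exp (K * T) * (w y T ^ 2 * η y)) + ∫ t in Set.Ioc s T, -∫ y, P y t := by
    rw [integral_neg, ← hswap]
    ring
  rw [hkey]
  refine ENNReal.ofReal_add_le.trans (add_le_add le_rfl ?_)
  refine (ofReal_integral_le_lintegral_ofReal _).trans ?_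
  refine setLIntegral_mono' measurableSet_Ioc fun t ht => ?_
  have ht₀ : 0 < t := hs.trans ht.1
  have hu := contDiff_slice hw ht₀
  have hq : -∫ y, P y t = ∫ y, Real.exp (K * t) *
      (2 * ∑ i, ∑ j, A i j * (pd d (fun z => w z t) j y *
        (pd d (fun z => w z t) i y * η y + w y t * pd d η i y)) - K * (w y t ^ 2 * η y)) := by
    have i₁ : Integrable fun y => K * (w y t ^ 2 * η y) :=
      Continuous.integrable_of_hasCompactSupport
        (continuous_const.mul ((hu.continuous.pow 2).mul hη.continuous)) hηc.mul_left.mul_left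
    have i₂ : Integrable fun y => w y t * η y *
        ∑ i, ∑ j, A i j * pd d (fun y => pd d (fun z => w z t) j y) i y :=
      Continuous.integrable_of_hasCompactSupport
        ((hu.continuous.mul hη.continuous).mul <| continuous_finsetSum _ fun i _ =>
          continuous_finsetSum _ fun j _ => continuous_const.mul
            (contDiff_pd (contDiff_pd hu j) i).continuous) hηc.mul_left.mul_right
    have i₃ : Integrable fun y => ∑ i, ∑ j, A i j * (pd d (fun z => w z t) j y *
        (pd d (fun z => w z t) i y * η y + w y t * pd d η i y)) := by
      refine integrable_finsetSum _ fun i _ => integrable_finsetSum _ fun j _ => ?_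
      refine Integrable.const_mul ?_ _
      refine Continuous.integrable_of_hasCompactSupport
        ((contDiff_pd hu j).continuous.mul (((contDiff_pd hu i).continuous.mul hη.continuous).add
          (hu.continuous.mul (contDiff_pd hη i).continuous))) ?_
      exact (hηc.mul_left.add
        (hηc.fderiv_apply (𝕜 := ℝ) (Pi.single i 1)).mul_left).mul_left
    simp only [hP, heq _ t ht₀]
    rw [integral_const_mul, integral_const_mul, integral_add i₁ (i₂.const_mul 2),
      integral_sub (i₃.const_mul 2) i₁, integral_const_mul 2, integral_const_mul 2,
      integral_mul_elliptic_eq A hu hη hηc]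
    ring
  rw [hq]
  refine (ofReal_integral_le_lintegral_ofReal _).trans ?_
  exact lintegral_mono fun y => ENNReal.ofReal_le_ofReal (hH t ht y)

end SpaceTime

/-- Multiscale Poincaré inequality. For `d ≥ 1` and `Λ ≥ 1` there is `C(d,Λ) < ∞` such
that: for every real symmetric `d×d` matrix `ā` with eigenvalues in `[1,Λ]` (expressed by
the equivalent quadratic-form bounds `|ξ|² ≤ ξ·āξ ≤ Λ|ξ|²`) and every `R > 0`, if
`w : ℝ^d × [0,∞) → ℝ` is continuous, smooth on `ℝ^d × (0,∞)`, solves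
`∂_t w = ∑_{ij} ā_{ij} ∂_i ∂_j w` on `ℝ^d × (0,∞)`, has polynomial growth in `x`
(together with its spatial gradient) locally uniformly for `t` in compact subsets of
`(0,R²]`, and satisfies the stated weighted integrability conditions with respect to the
weight `Ψ_R(y) = R^{-d} exp(-|y|/R)` (with `|y|` the Euclidean norm), then for every
`σ ∈ (0,1]`:
`∫ |w(y,0)|² Ψ_R ≤ C ∫ |w(y,(σR)²)|² Ψ_R + C ∫₀^{(σR)²} ∫ |∇w(y,t)|² Ψ_R dy dt`. -/
theorem stmt_14 (d : ℕ) (hd : 1 ≤ d) (Λ : ℝ) (hΛ : 1 ≤ Λ) :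
    ∃ C : ℝ, 0 < C ∧
      ∀ A : Matrix (Fin d) (Fin d) ℝ, A.IsSymm →
        (∀ ξ : Fin d → ℝ,
          (∑ i, ξ i ^ 2) ≤ ξ ⬝ᵥ A.mulVec ξ ∧ ξ ⬝ᵥ A.mulVec ξ ≤ Λ * ∑ i, ξ i ^ 2) →
      ∀ R : ℝ, 0 < R →
      ∀ w : (Fin d → ℝ) → ℝ → ℝ,
        ContinuousOn (fun p : (Fin d → ℝ) × ℝ => w p.1 p.2) {p | 0 ≤ p.2} →
        ContDiffOn ℝ ((⊤ : ℕ∞) : WithTop ℕ∞) (fun p : (Fin d → ℝ) × ℝ => w p.1 p.2)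
          {p | 0 < p.2} →
        (∀ x : Fin d → ℝ, ∀ t : ℝ, 0 < t →
          deriv (fun τ => w x τ) t =
            ∑ i, ∑ j, A i j * pd d (fun y => pd d (fun z => w z t) j y) i x) →
        (∀ t₀ t₁ : ℝ, 0 < t₀ → t₁ ≤ R ^ 2 →
          ∃ M : ℝ, ∃ n : ℕ, ∀ t ∈ Set.Icc t₀ t₁, ∀ x : Fin d → ℝ,
            |w x t| + ∑ i, |pd d (fun z => w z t) i x| ≤
              M * (1 + Real.sqrt (∑ i, x i ^ 2)) ^ n) →
        (∫⁻ y : Fin d → ℝ, ENNReal.ofReal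
            ((w y 0) ^ 2 * (Real.exp (-Real.sqrt (∑ i, y i ^ 2) / R) / R ^ d))) < ⊤ →
        (∫⁻ t in Set.Ioc (0 : ℝ) (R ^ 2), ∫⁻ y : Fin d → ℝ, ENNReal.ofReal
            (((w y t) ^ 2 + ∑ i, (pd d (fun z => w z t) i y) ^ 2) *
              (Real.exp (-Real.sqrt (∑ i, y i ^ 2) / R) / R ^ d))) < ⊤ →
        ∀ σ : ℝ, 0 < σ → σ ≤ 1 →
          (∫⁻ y : Fin d → ℝ, ENNReal.ofReal
              ((w y 0) ^ 2 * (Real.exp (-Real.sqrt (∑ i, y i ^ 2) / R) / R ^ d)))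
            ≤ ENNReal.ofReal C *
                (∫⁻ y : Fin d → ℝ, ENNReal.ofReal
                  ((w y ((σ * R) ^ 2)) ^ 2 *
                    (Real.exp (-Real.sqrt (∑ i, y i ^ 2) / R) / R ^ d)))
              + ENNReal.ofReal C *
                (∫⁻ t in Set.Ioc (0 : ℝ) ((σ * R) ^ 2), ∫⁻ y : Fin d → ℝ, ENNReal.ofReal
                  ((∑ i, (pd d (fun z => w z t) i y) ^ 2) *
                    (Real.exp (-Real.sqrt (∑ i, y i ^ 2) / R) / R ^ d))) := by
  refine ⟨3 * Λ * Real.exp (1 + Λ), by positivity, ?_⟩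
  intro A hA hell R hR w hw₀ hw heq _ _ hfin σ hσ hσ₁
  obtain ⟨Φ, a, hΦ, hΦ₀, hΦΨ, hΨΦ, hΦa, ha⟩ := exists_smooth_exp_weight d hR
  obtain ⟨θ, M, hθ, hθc, hθ₀, hθ₁, hθz, hM, hθM⟩ := exists_smooth_cutoff d
  set Ψ : (Fin d → ℝ) → ℝ := fun y => Real.exp (-Real.sqrt (∑ i, y i ^ 2) / R) / R ^ d
  have hΨc : Continuous Ψ := by fun_prop
  have hΛ₀ : 0 ≤ Λ := by linarith
  set T := (σ * R) ^ 2 with hT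
  have hT₀ : 0 < T := by positivity
  have hTR : T ≤ R ^ 2 := by
    rw [hT, mul_pow]
    exact mul_le_of_le_one_left (by positivity) (pow_le_one₀ hσ.le hσ₁)
  set K := Λ * (1 / R ^ 2) with hK
  have hK₀ : 0 ≤ K := by positivity
  have hKT : ∀ {t}, t ≤ T → Real.exp (K * t) ≤ Real.exp Λ := fun {t} ht => by
    refine Real.exp_le_exp.2 ?_
    calc K * t ≤ K * R ^ 2 := by gcongr; exact ht.trans hTR
      _ = Λ := by rw [hK]; field_simp
  set G : (Fin d → ℝ) → ℝ → ℝ := fun y t => ∑ i, pd d (fun z => w z t) i y ^ 2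
  have hG₀ : ∀ y t, 0 ≤ G y t := fun y t => Finset.sum_nonneg fun i _ => sq_nonneg _
  have hGc : ContinuousOn (fun p : (Fin d → ℝ) × ℝ => G p.1 p.2) {p | 0 < p.2} :=
    continuousOn_finsetSum _ fun i _ => (continuousOn_pd hw i).pow 2
  have hΨc' : ContinuousOn (fun p : (Fin d → ℝ) × ℝ => Ψ p.1) {p | 0 < p.2} :=
    (hΨc.comp continuous_fst).continuousOn
  set E := ∫⁻ t in Set.Ioc (0 : ℝ) T, ∫⁻ y, ENNReal.ofReal ((w y t ^ 2 + G y t) * Ψ y) with hE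
  have hEfin : E ≠ ⊤ :=
    ((lintegral_mono_set (Set.Ioc_subset_Ioc_right hTR)).trans_lt hfin).ne
  set I := ∫⁻ t in Set.Ioc (0 : ℝ) T, ∫⁻ y, ENNReal.ofReal (G y t * Ψ y) with hI
  set J := ∫⁻ y, ENNReal.ofReal (w y T ^ 2 * Ψ y) with hJ
  set L := Real.exp Λ
  have hL₀ : 0 < L := Real.exp_pos _
  have hcut : ∀ ε s, 0 < ε → 0 < s → s ≤ T →
      ∫⁻ y, ENNReal.ofReal (Real.exp (K * s) * (w y s ^ 2 * (θ (ε • y) * Φ y))) ≤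
        ENNReal.ofReal L * J + (ENNReal.ofReal (L * (3 * Λ)) * I +
          ENNReal.ofReal (ε * (L * (Λ * (1 + M)))) * E) := by
    intro ε s hε hs hsT
    have hχ : ContDiff ℝ (⊤ : ℕ∞) fun y : Fin d → ℝ => θ (ε • y) := by fun_prop
    have hχc : HasCompactSupport fun y : Fin d → ℝ => θ (ε • y) := hθc.comp_smul hε.ne'
    have hη : ContDiff ℝ (⊤ : ℕ∞) fun y => θ (ε • y) * Φ y := hχ.mul hΦ
    have hηc : HasCompactSupport fun y => θ (ε • y) * Φ y := hχc.mul_right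
    have hη₀ : ∀ y, 0 ≤ θ (ε • y) * Φ y := fun y => mul_nonneg (hθ₀ _) (hΦ₀ y)
    have hηΨ : ∀ y, θ (ε • y) * Φ y ≤ Ψ y := fun y =>
      (mul_le_of_le_one_left (hΦ₀ y) (hθ₁ _)).trans (hΦΨ y)
    have hpdη : ∀ y i, pd d (fun y => θ (ε • y) * Φ y) i y =
        θ (ε • y) * (Φ y * a y i) + ε * pd d θ i (ε • y) * Φ y := fun y i => by
      rw [pd_mul (hχ.differentiable (by simp) y) (hΦ.differentiable (by simp) y), hΦa,
        pd_comp_smul]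
    have hint : ∀ t, 0 < t →
        Integrable fun y => Real.exp (K * t) * (w y t ^ 2 * (θ (ε • y) * Φ y)) := fun t ht =>
      Continuous.integrable_of_hasCompactSupport
        (continuous_const.mul (((contDiff_slice hw ht).continuous.pow 2).mul hη.continuous))
        hηc.mul_left.mul_left
    have hnn : ∀ t y, 0 ≤ Real.exp (K * t) * (w y t ^ 2 * (θ (ε • y) * Φ y)) := fun t y =>
      mul_nonneg (Real.exp_pos _).le (mul_nonneg (sq_nonneg _) (hη₀ y))
    have hen := ofReal_weighted_energy_le hw heq hη hηc (K := K) hs hsT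
      (H := fun y t => L * (3 * Λ) * (G y t * Ψ y) +
        ε * (L * (Λ * (1 + M))) * ((w y t ^ 2 + G y t) * Ψ y)) (fun t ht y => by
        have hf := flux_le hΛ₀ hA hell (hθ₀ (ε • y)) (hθ₁ (ε • y)) (hΦ₀ y) hε.le hM (w y t)
          (fun i => pd d (fun z => w z t) i y) (a y) (fun i => pd d θ i (ε • y)) (ha y) (hθM _)
        simp only [← hpdη] at hf
        have h0 : 0 ≤ 3 * Λ * G y t + ε * (Λ * (1 + M)) * (w y t ^ 2 + G y t) := by
          have := hG₀ y t
          positivity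
        calc _ ≤ Real.exp (K * t) *
              ((3 * Λ * G y t + ε * (Λ * (1 + M)) * (w y t ^ 2 + G y t)) * Φ y) := by
              refine mul_le_mul_of_nonneg_left ?_ (Real.exp_pos _).le
              linarith
          _ ≤ L * ((3 * Λ * G y t + ε * (Λ * (1 + M)) * (w y t ^ 2 + G y t)) * Ψ y) := by
              gcongr
              · exact mul_nonneg h0 (hΦ₀ y)
              · exact hKT ht.2
              · exact hΦΨ y
          _ = _ := by ring)
    rw [ofReal_integral_eq_lintegral_ofReal (hint s hs) (.of_forall (hnn s)),
      ofReal_integral_eq_lintegral_ofReal (hint T hT₀) (.of_forall (hnn T))] at hen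
    refine hen.trans (add_le_add ?_ ?_)
    · rw [hJ, ← lintegral_const_mul' _ _ ENNReal.ofReal_ne_top]
      refine lintegral_mono fun y => ?_
      rw [← ENNReal.ofReal_mul hL₀.le]
      refine ENNReal.ofReal_le_ofReal ?_
      gcongr
      · exact mul_nonneg (sq_nonneg _) (hη₀ y)
      · exact hKT le_rfl
      · exact hηΨ y
    · refine (lintegral_mono_set (Set.Ioc_subset_Ioc_left hs.le)).trans ?_
      rw [hI, hE, ← lintegral_const_mul' _ _ ENNReal.ofReal_ne_top,
        ← lintegral_const_mul' _ _ ENNReal.ofReal_ne_top,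
        ← lintegral_add_left'
          ((aemeasurable_lintegral_of_continuousOn (hGc.mul hΨc') le_rfl).const_mul _)]
      refine setLIntegral_mono' measurableSet_Ioc fun t ht => ?_
      rw [← lintegral_const_mul' _ _ ENNReal.ofReal_ne_top,
        ← lintegral_const_mul' _ _ ENNReal.ofReal_ne_top, ← lintegral_add_left']
      · refine lintegral_mono fun y => ?_
        rw [← ENNReal.ofReal_mul (by positivity), ← ENNReal.ofReal_mul (by positivity)]
        exact ENNReal.ofReal_add_le
      · have hGt : Continuous fun y => G y t := continuous_finsetSum _ fun i _ =>
          (contDiff_pd (contDiff_slice hw ht.1) i).continuous.pow 2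
        exact ((hGt.mul hΨc).measurable.ennreal_ofReal.const_mul _).aemeasurable
  have hlim : ∫⁻ y, ENNReal.ofReal (w y 0 ^ 2 * Φ y) ≤
      ENNReal.ofReal L * J + ENNReal.ofReal (L * (3 * Λ)) * I := by
    set ε : ℕ → ℝ := fun n => 1 / ((n : ℝ) + 1) with hε
    have hε₀ : ∀ n, 0 < ε n := fun n => by positivity
    have hε₁ : ∀ n, ε n ≤ 1 := fun n => by
      rw [hε, div_le_one (by positivity)]
      exact le_add_of_nonneg_left n.cast_nonneg
    have hεt : Filter.Tendsto ε Filter.atTop (nhds 0) := tendsto_one_div_add_atTop_nhds_zero_nat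
    have hεT : Filter.Tendsto (fun n => ε n * T) Filter.atTop (nhds 0) := by
      simpa using hεt.mul_const T
    have hs₀ : ∀ n, 0 < ε n * T := fun n => mul_pos (hε₀ n) hT₀
    have hpt : ∀ y, Filter.Tendsto (fun n => ENNReal.ofReal
        (Real.exp (K * (ε n * T)) * (w y (ε n * T) ^ 2 * (θ (ε n • y) * Φ y)))) Filter.atTop
        (nhds (ENNReal.ofReal (w y 0 ^ 2 * Φ y))) := fun y => by
      refine ENNReal.tendsto_ofReal ?_
      have h₁ : Filter.Tendsto (fun n => Real.exp (K * (ε n * T))) Filter.atTop (nhds 1) := by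
        have := (Real.continuous_exp.tendsto _).comp (hεT.const_mul K)
        simpa [Function.comp_def] using this
      have h₂ : Filter.Tendsto (fun n => w y (ε n * T)) Filter.atTop (nhds (w y 0)) := by
        have hc := (hw₀ (y, 0) (show (0 : ℝ) ≤ 0 from le_rfl)).tendsto
        exact hc.comp (f := fun n => (y, ε n * T)) (tendsto_nhdsWithin_iff.2
          ⟨tendsto_const_nhds.prodMk_nhds hεT, .of_forall fun n => (hs₀ n).le⟩)
      have h₃ : Filter.Tendsto (fun n => θ (ε n • y)) Filter.atTop (nhds 1) := by
        have := (hθ.continuous.tendsto _).comp (hεt.smul_const y)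
        simpa [hθz, Function.comp_def] using this
      simpa using h₁.mul ((h₂.pow 2).mul (h₃.mul_const (Φ y)))
    have hR : Filter.Tendsto (fun n => ENNReal.ofReal L * J + (ENNReal.ofReal (L * (3 * Λ)) * I +
        ENNReal.ofReal (ε n * (L * (Λ * (1 + M)))) * E)) Filter.atTop
        (nhds (ENNReal.ofReal L * J + (ENNReal.ofReal (L * (3 * Λ)) * I + 0))) := by
      refine tendsto_const_nhds.add (tendsto_const_nhds.add ?_)
      have := ENNReal.Tendsto.mul_const
        (ENNReal.tendsto_ofReal (hεt.mul_const (L * (Λ * (1 + M))))) (Or.inr hEfin)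
      simpa using this
    calc ∫⁻ y, ENNReal.ofReal (w y 0 ^ 2 * Φ y)
        = ∫⁻ y, Filter.liminf (fun n => ENNReal.ofReal
            (Real.exp (K * (ε n * T)) * (w y (ε n * T) ^ 2 * (θ (ε n • y) * Φ y))))
            Filter.atTop := lintegral_congr fun y => (hpt y).liminf_eq.symm
      _ ≤ Filter.liminf (fun n => ∫⁻ y, ENNReal.ofReal
            (Real.exp (K * (ε n * T)) * (w y (ε n * T) ^ 2 * (θ (ε n • y) * Φ y))))
            Filter.atTop := by
          refine lintegral_liminf_le fun n => Measurable.ennreal_ofReal ?_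
          have h₁ := (contDiff_slice hw (hs₀ n)).continuous
          have h₂ := hθ.continuous
          have h₃ := hΦ.continuous
          exact Continuous.measurable (by fun_prop)
      _ ≤ Filter.liminf (fun n => ENNReal.ofReal L * J + (ENNReal.ofReal (L * (3 * Λ)) * I +
            ENNReal.ofReal (ε n * (L * (Λ * (1 + M)))) * E)) Filter.atTop :=
          Filter.liminf_le_liminf (.of_forall fun n => hcut (ε n) (ε n * T) (hε₀ n) (hs₀ n)
            (mul_le_of_le_one_left hT₀.le (hε₁ n)))
      _ = _ := by rw [hR.liminf_eq, add_zero]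
  calc ∫⁻ y, ENNReal.ofReal (w y 0 ^ 2 * Ψ y)
      ≤ ENNReal.ofReal (Real.exp 1) * ∫⁻ y, ENNReal.ofReal (w y 0 ^ 2 * Φ y) := by
        rw [← lintegral_const_mul' _ _ ENNReal.ofReal_ne_top]
        refine lintegral_mono fun y => ?_
        rw [← ENNReal.ofReal_mul (Real.exp_pos 1).le]
        refine ENNReal.ofReal_le_ofReal ?_
        have := mul_le_mul_of_nonneg_left (hΨΦ y) (sq_nonneg (w y 0))
        linarith
    _ ≤ ENNReal.ofReal (Real.exp 1) *
          (ENNReal.ofReal L * J + ENNReal.ofReal (L * (3 * Λ)) * I) := by gcongr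
    _ ≤ _ := by
        rw [mul_add, ← mul_assoc, ← mul_assoc, ← ENNReal.ofReal_mul (Real.exp_pos 1).le,
          ← ENNReal.ofReal_mul (Real.exp_pos 1).le]
        have h₁ : Real.exp 1 * L = Real.exp (1 + Λ) := (Real.exp_add 1 Λ).symm
        rw [← mul_assoc, h₁, mul_comm (Real.exp (1 + Λ)) (3 * Λ)]
        gcongr
        exact le_mul_of_one_le_left (Real.exp_pos _).le (by linarith)
end

section
/- Let d ≥ 1 and k ≥ 0 be integers and Λ ≥ 1. There exists a constant C(k, d, Λ) < ∞ such that the following holds for every real symmetric d×d matrix ā all of whose eigenvalues lie in [1, Λ], with associated heat kernel Φ. For every polynomial q : ℝ^d → ℝ of total degree at most k and every pair of radii r, R with 1 ≤ r ≤ R/√2, there exists a polynomial q̃ : ℝ^d → ℝ of total degree at most k such that (∫_{ℝ^d} |q̃(x)|² Φ_R(x) dx)^{1/2} ≤ C (∫_{ℝ^d} |q(x)|² Φ_R(x) dx)^{1/2}, and such that for every measurable F : ℝ^d → ℝ with ∫_{ℝ^d} |F(x)|² Φ_R(x) dx < ∞ one has ∫_{ℝ^d} F(x) q(x) Φ_R(x)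 dx = ∫_{ℝ^d} Φ_{√(R²−r²)}(y) q̃(y) ( ∫_{ℝ^d} Φ(x−y, r²) F(x) dx ) dy. -/
open MeasureTheory Matrix

/-- The heat kernel of the matrix `A`:
`Φ(x,t) = (4πt)^{-d/2} (det A)^{-1/2} exp(-(x · A⁻¹ x)/(4t))`. -/
noncomputable def heatKer (d : ℕ) (A : Matrix (Fin d) (Fin d) ℝ) (x : Fin d → ℝ)
    (t : ℝ) : ℝ :=
  (4 * Real.pi * t) ^ (-(d : ℝ) / 2) * A.det ^ (-(1 : ℝ) / 2) *
    Real.exp (-(x ⬝ᵥ A⁻¹.mulVec x) / (4 * t))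

/-- `q` is (given by) a polynomial of total degree at most `k`. -/
def IsPolyOfDeg (d k : ℕ) (q : (Fin d → ℝ) → ℝ) : Prop :=
  ∃ P : MvPolynomial (Fin d) ℝ, P.totalDegree ≤ k ∧ ∀ x, q x = MvPolynomial.eval x P

open scoped MatrixOrder in
lemma Matrix.PosDef.exists_inv_eq_transpose_mul_self {d : ℕ} {A : Matrix (Fin d) (Fin d) ℝ}
    (hA : A.PosDef) : ∃ B : Matrix (Fin d) (Fin d) ℝ, A⁻¹ = Bᵀ * B ∧ B.det ≠ 0 := by
  obtain ⟨B, hB⟩ := CStarAlgebra.nonneg_iff_eq_star_mul_self.mp hA.inv.posSemidef.nonneg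
  have hB' : A⁻¹ = Bᵀ * B := by
    rw [hB, star_eq_conjTranspose, conjTranspose_eq_transpose_of_trivial]
  refine ⟨B, hB', fun h0 => ?_⟩
  have := hA.inv.det_pos
  rw [hB', det_mul, h0, mul_zero] at this
  exact lt_irrefl _ this

lemma dotProduct_transpose_mul_mulVec {d : ℕ} (B : Matrix (Fin d) (Fin d) ℝ) (x : Fin d → ℝ) :
    x ⬝ᵥ (Bᵀ * B).mulVec x = ∑ i, (B.mulVec x i) ^ 2 := by
  rw [← mulVec_mulVec, dotProduct_mulVec, vecMul_transpose]
  simp [dotProduct, sq]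

lemma integral_exp_neg_sum_sq_div (d : ℕ) {t : ℝ} (ht : 0 < t) :
    ∫ z : Fin d → ℝ, Real.exp (-(∑ i, z i ^ 2) / (4 * t)) = Real.sqrt (4 * Real.pi * t) ^ d := by
  have h (z : Fin d → ℝ) : Real.exp (-(∑ i, z i ^ 2) / (4 * t)) =
      ∏ i, Real.exp (-(1 / (4 * t)) * z i ^ 2) := by
    rw [← Real.exp_sum, ← Finset.mul_sum]
    congr 1
    ring
  simp_rw [h]
  rw [integral_fintype_prod_volume_eq_pow (fun u : ℝ => Real.exp (-(1 / (4 * t)) * u ^ 2)),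
    integral_gaussian, Fintype.card_fin]
  congr 2
  field_simp

lemma heatKer_nonneg {d : ℕ} {A : Matrix (Fin d) (Fin d) ℝ} (hA : A.PosDef) {t : ℝ} (ht : 0 < t)
    (x : Fin d → ℝ) : 0 ≤ heatKer d A x t := by
  have := hA.det_pos
  unfold heatKer
  positivity

lemma continuous_heatKer {d : ℕ} (A : Matrix (Fin d) (Fin d) ℝ) (t : ℝ) :
    Continuous fun x => heatKer d A x t := by
  unfold heatKer
  fun_prop

lemma integral_heatKer {d : ℕ} {A : Matrix (Fin d) (Fin d) ℝ} (hA : A.PosDef) {t : ℝ}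
    (ht : 0 < t) : ∫ x, heatKer d A x t = 1 := by
  obtain ⟨B, hB, hdet⟩ := hA.exists_inv_eq_transpose_mul_self
  have hmap := Real.map_matrix_volume_pi_eq_smul_volume_pi hdet
  have heq : ∫ x : Fin d → ℝ, Real.exp (-(x ⬝ᵥ A⁻¹.mulVec x) / (4 * t)) =
      |B.det|⁻¹ * Real.sqrt (4 * Real.pi * t) ^ d := by
    rw [← integral_exp_neg_sum_sq_div d ht, ← abs_inv]
    have h1 := integral_map (μ := volume) (φ := Matrix.toLin' B)
      (Matrix.toLin' B).continuous_of_finiteDimensional.aemeasurable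
      (f := fun z : Fin d → ℝ => Real.exp (-(∑ i, z i ^ 2) / (4 * t)))
      (by apply Continuous.aestronglyMeasurable; fun_prop)
    rw [hmap, integral_smul_measure, ENNReal.toReal_ofReal (abs_nonneg _), smul_eq_mul] at h1
    rw [h1, hB]
    simp_rw [dotProduct_transpose_mul_mulVec, Matrix.toLin'_apply]
  have hdetA : A.det ^ (-(1 : ℝ) / 2) = |B.det| := by
    have h2 : A.det = (|B.det| ^ 2)⁻¹ := by
      have h3 : A⁻¹.det = B.det ^ 2 := by rw [hB, det_mul, det_transpose, sq]
      rw [sq_abs, ← h3, det_nonsing_inv, Ring.inverse_eq_inv', inv_inv]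
    rw [h2, ← Real.rpow_natCast, ← Real.rpow_neg (abs_nonneg _), ← Real.rpow_mul (abs_nonneg _)]
    norm_num
  have hpi : 0 < 4 * Real.pi * t := by positivity
  unfold heatKer
  rw [integral_const_mul, heq, hdetA, Real.sqrt_eq_rpow, ← Real.rpow_natCast,
    ← Real.rpow_mul hpi.le, neg_div, Real.rpow_neg hpi.le]
  have : |B.det| ≠ 0 := abs_ne_zero.mpr hdet
  have h5 : (4 * Real.pi * t) ^ ((d : ℝ) / 2) ≠ 0 := (Real.rpow_pos_of_pos hpi _).ne'
  rw [show 1 / 2 * (d : ℝ) = d / 2 by ring]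
  field_simp

lemma integrable_heatKer {d : ℕ} {A : Matrix (Fin d) (Fin d) ℝ} (hA : A.PosDef) {t : ℝ}
    (ht : 0 < t) : Integrable fun x => heatKer d A x t :=
  Integrable.of_integral_ne_zero (by rw [integral_heatKer hA ht]; exact one_ne_zero)

lemma heatKer_mul_heatKer {d : ℕ} (A : Matrix (Fin d) (Fin d) ℝ) {s r : ℝ}
    (hs : 0 < s) (hr : 0 < r) (x y : Fin d → ℝ) :
    heatKer d A y s * heatKer d A (x - y) r =
      heatKer d A x (s + r) * heatKer d A (y - (s / (s + r)) • x) (s * r / (s + r)) := by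
  have hsr : 0 < s + r := by positivity
  have hpi := Real.pi_pos
  have hpre : (4 * Real.pi * s) ^ (-(d : ℝ) / 2) * (4 * Real.pi * r) ^ (-(d : ℝ) / 2) =
      (4 * Real.pi * (s + r)) ^ (-(d : ℝ) / 2) *
        (4 * Real.pi * (s * r / (s + r))) ^ (-(d : ℝ) / 2) := by
    rw [← Real.mul_rpow (by positivity) (by positivity),
      ← Real.mul_rpow (by positivity) (by positivity)]
    congr 1
    field_simp
  have hexp : Real.exp (-(y ⬝ᵥ A⁻¹.mulVec y) / (4 * s)) *
      Real.exp (-((x - y) ⬝ᵥ A⁻¹.mulVec (x - y)) / (4 * r)) =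
      Real.exp (-(x ⬝ᵥ A⁻¹.mulVec x) / (4 * (s + r))) *
      Real.exp (-((y - (s / (s + r)) • x) ⬝ᵥ A⁻¹.mulVec (y - (s / (s + r)) • x)) /
        (4 * (s * r / (s + r)))) := by
    rw [← Real.exp_add, ← Real.exp_add]
    congr 1
    simp only [mulVec_sub, mulVec_smul, sub_dotProduct, dotProduct_sub, smul_dotProduct,
      dotProduct_smul, smul_eq_mul]
    field_simp
    ring
  unfold heatKer
  linear_combination
    (A.det ^ (-(1 : ℝ) / 2)) ^ 2 * Real.exp (-(y ⬝ᵥ A⁻¹.mulVec y) / (4 * s)) *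
      Real.exp (-((x - y) ⬝ᵥ A⁻¹.mulVec (x - y)) / (4 * r)) * hpre +
    (A.det ^ (-(1 : ℝ) / 2)) ^ 2 * ((4 * Real.pi * (s + r)) ^ (-(d : ℝ) / 2) *
        (4 * Real.pi * (s * r / (s + r))) ^ (-(d : ℝ) / 2)) * hexp

lemma heatKer_le_of_le {d : ℕ} {A : Matrix (Fin d) (Fin d) ℝ} (hA : A.PosDef) {s t : ℝ}
    (hs : 0 < s) (hst : s ≤ t) (hts : t ≤ 2 * s) (x : Fin d → ℝ) :
    heatKer d A x s ≤ 2 ^ ((d : ℝ) / 2) * heatKer d A x t := by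
  have hdet := hA.det_pos
  have hpi := Real.pi_pos
  have ht : 0 < t := hs.trans_le hst
  have hpre : (4 * Real.pi * s) ^ (-(d : ℝ) / 2) ≤
      2 ^ ((d : ℝ) / 2) * (4 * Real.pi * t) ^ (-(d : ℝ) / 2) := by
    have h1 : (4 * Real.pi * s) ^ (-(d : ℝ) / 2) ≤ (4 * Real.pi * t / 2) ^ (-(d : ℝ) / 2) := by
      apply Real.rpow_le_rpow_of_nonpos (by positivity)
      · nlinarith
      · have : (0 : ℝ) ≤ d := by positivity
        linarith
    rw [Real.div_rpow (by positivity) (by norm_num), neg_div,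
      Real.rpow_neg (zero_le_two (α := ℝ)), div_inv_eq_mul] at h1
    rw [neg_div]
    linarith
  have hexp : Real.exp (-(x ⬝ᵥ A⁻¹.mulVec x) / (4 * s)) ≤
      Real.exp (-(x ⬝ᵥ A⁻¹.mulVec x) / (4 * t)) := by
    apply Real.exp_le_exp.mpr
    have h0 : 0 ≤ x ⬝ᵥ A⁻¹.mulVec x := by
      simpa using hA.inv.posSemidef.dotProduct_mulVec_nonneg x
    rw [neg_div, neg_div, neg_le_neg_iff]
    gcongr
  unfold heatKer
  calc _ ≤ (2 ^ ((d : ℝ) / 2) * (4 * Real.pi * t) ^ (-(d : ℝ) / 2)) * A.det ^ (-(1 : ℝ) / 2) *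
        Real.exp (-(x ⬝ᵥ A⁻¹.mulVec x) / (4 * t)) := by gcongr
    _ = _ := by ring

lemma exists_heatKer_le_exp_neg_sum_sq {d : ℕ} {A : Matrix (Fin d) (Fin d) ℝ} (hA : A.PosDef)
    {t : ℝ} (ht : 0 < t) : ∃ K b : ℝ, 0 < b ∧
      ∀ x, heatKer d A x t ≤ K * ∏ i, Real.exp (-b * x i ^ 2) := by
  obtain ⟨B, hB, hdet⟩ := hA.exists_inv_eq_transpose_mul_self
  have hAdet := hA.det_pos
  have hpi := Real.pi_pos
  obtain ⟨M, hM, hMB⟩ : ∃ M : ℝ, 0 < M ∧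
      ∀ z : Fin d → ℝ, ∑ i, (B⁻¹.mulVec z i) ^ 2 ≤ M * ∑ i, z i ^ 2 := by
    refine ⟨∑ i, ∑ j, B⁻¹ i j ^ 2 + 1, by positivity, fun z => ?_⟩
    have h1 : ∑ i, (B⁻¹.mulVec z i) ^ 2 ≤ (∑ i, ∑ j, B⁻¹ i j ^ 2) * ∑ i, z i ^ 2 := by
      rw [Finset.sum_mul]
      exact Finset.sum_le_sum fun i _ =>
        Finset.sum_mul_sq_le_sq_mul_sq Finset.univ (fun j => B⁻¹ i j) z
    have h2 : 0 ≤ ∑ i, z i ^ 2 := by positivity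
    linarith
  refine ⟨(4 * Real.pi * t) ^ (-(d : ℝ) / 2) * A.det ^ (-(1 : ℝ) / 2), 1 / (4 * t * M),
    by positivity, fun x => ?_⟩
  rw [← Real.exp_sum]
  unfold heatKer
  gcongr
  rw [hB, dotProduct_transpose_mul_mulVec, ← Finset.mul_sum]
  have h3 := hMB (B.mulVec x)
  rw [mulVec_mulVec, nonsing_inv_mul _ (isUnit_iff_ne_zero.mpr hdet), one_mulVec] at h3
  have : (∑ i, x i ^ 2) / M ≤ ∑ i, (B.mulVec x i) ^ 2 := by
    rw [div_le_iff₀ hM]; linarith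
  calc _ = -(∑ i, (B.mulVec x i) ^ 2) / (4 * t) := rfl
    _ ≤ -((∑ i, x i ^ 2) / M) / (4 * t) := by gcongr
    _ = _ := by field_simp

lemma integrable_eval_mul_heatKer {d : ℕ} {A : Matrix (Fin d) (Fin d) ℝ} (hA : A.PosDef)
    {t : ℝ} (ht : 0 < t) (P : MvPolynomial (Fin d) ℝ) :
    Integrable fun x => MvPolynomial.eval x P * heatKer d A x t := by
  obtain ⟨K, b, hb, hK⟩ := exists_heatKer_le_exp_neg_sum_sq hA ht
  simp_rw [MvPolynomial.eval_eq', Finset.sum_mul]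
  refine integrable_finsetSum _ fun m _ => ?_
  simp_rw [mul_assoc]
  refine Integrable.const_mul ?_ _
  have h1 : Integrable fun x : Fin d → ℝ => ∏ i, (x i ^ m i * Real.exp (-b * x i ^ 2)) := by
    refine Integrable.fintype_prod (f := fun i u => u ^ m i * Real.exp (-b * u ^ 2)) fun i => ?_
    have := integrable_rpow_mul_exp_neg_mul_sq hb (s := (m i : ℝ))
      (by have : (0 : ℝ) ≤ m i := by positivity
          linarith)
    simpa only [Real.rpow_natCast] using this
  refine (h1.norm.const_mul K).mono' ?_ (.of_forall fun x => ?_)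
  · have := continuous_heatKer A t
    apply Continuous.aestronglyMeasurable
    fun_prop
  · have h0 := heatKer_nonneg hA ht x
    have h2 : 0 ≤ ∏ i, Real.exp (-b * x i ^ 2) := by positivity
    rw [norm_mul, Finset.prod_mul_distrib, norm_mul, Real.norm_of_nonneg h0, Real.norm_of_nonneg h2]
    calc _ ≤ ‖∏ i, x i ^ m i‖ * (K * ∏ i, Real.exp (-b * x i ^ 2)) := by gcongr; exact hK x
      _ = _ := by ring

lemma IsPolyOfDeg.add {d k : ℕ} {p q : (Fin d → ℝ) → ℝ} (hp : IsPolyOfDeg d k p)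
    (hq : IsPolyOfDeg d k q) : IsPolyOfDeg d k fun x => p x + q x := by
  obtain ⟨P, hP, hp⟩ := hp
  obtain ⟨Q, hQ, hq⟩ := hq
  exact ⟨P + Q, (MvPolynomial.totalDegree_add _ _).trans (max_le hP hQ),
    fun x => by simp [hp, hq]⟩

lemma IsPolyOfDeg.const (d k : ℕ) (a : ℝ) : IsPolyOfDeg d k fun _ => a :=
  ⟨MvPolynomial.C a, by simp, fun x => by simp⟩

lemma IsPolyOfDeg.const_mul {d k : ℕ} {p : (Fin d → ℝ) → ℝ} (hp : IsPolyOfDeg d k p) (a : ℝ) :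
    IsPolyOfDeg d k fun x => a * p x := by
  obtain ⟨P, hP, hp⟩ := hp
  exact ⟨MvPolynomial.C a * P, (MvPolynomial.totalDegree_mul _ _).trans (by simpa using hP),
    fun x => by simp [hp]⟩

lemma IsPolyOfDeg.coord_mul {d k : ℕ} {p : (Fin d → ℝ) → ℝ} (hp : IsPolyOfDeg d k p)
    (i : Fin d) : IsPolyOfDeg d (k + 1) fun x => x i * p x := by
  obtain ⟨P, hP, hp⟩ := hp
  refine ⟨MvPolynomial.X i * P, (MvPolynomial.totalDegree_mul _ _).trans ?_,
    fun x => by simp [hp]⟩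
  rw [MvPolynomial.totalDegree_X]
  omega

lemma IsPolyOfDeg.mono {d k l : ℕ} {p : (Fin d → ℝ) → ℝ} (hp : IsPolyOfDeg d k p)
    (h : k ≤ l) : IsPolyOfDeg d l p := by
  obtain ⟨P, hP, hp⟩ := hp
  exact ⟨P, hP.trans h, hp⟩

lemma IsPolyOfDeg.sum {d k : ℕ} {ι : Type*} (s : Finset ι) {p : ι → (Fin d → ℝ) → ℝ}
    (hp : ∀ i ∈ s, IsPolyOfDeg d k (p i)) : IsPolyOfDeg d k fun x => ∑ i ∈ s, p i x := by
  classical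
  induction s using Finset.induction_on with
  | empty => simpa using IsPolyOfDeg.const d k 0
  | insert a s ha ih =>
    simp_rw [Finset.sum_insert ha]
    exact (hp a (Finset.mem_insert_self a s)).add
      (ih fun i hi => hp i (Finset.mem_insert_of_mem hi))

lemma IsPolyOfDeg.continuous {d k : ℕ} {p : (Fin d → ℝ) → ℝ} (hp : IsPolyOfDeg d k p) :
    Continuous p := by
  obtain ⟨P, hP, hp⟩ := hp
  rw [funext hp]
  exact MvPolynomial.continuous_eval P

lemma exists_eval_add {d : ℕ} (P : MvPolynomial (Fin d) ℝ) (v : Fin d → ℝ) :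
    ∃ Q : MvPolynomial (Fin d) ℝ, ∀ g, MvPolynomial.eval (v + g) P = MvPolynomial.eval g Q := by
  refine ⟨MvPolynomial.bind₁ (fun i => MvPolynomial.C (v i) + MvPolynomial.X i) P, fun g => ?_⟩
  rw [← MvPolynomial.coe_aeval_eq_eval, ← MvPolynomial.coe_aeval_eq_eval]
  simp only [RingHom.coe_coe, MvPolynomial.aeval_bind₁]
  congr 2
  funext i
  simp

lemma integrable_eval_add_mul_mul {d : ℕ} {w : (Fin d → ℝ) → ℝ}
    (hw : ∀ P : MvPolynomial (Fin d) ℝ, Integrable fun x => MvPolynomial.eval x P * w x)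
    (P R : MvPolynomial (Fin d) ℝ) (v : Fin d → ℝ) :
    Integrable fun g => MvPolynomial.eval (v + g) P * MvPolynomial.eval g R * w g := by
  obtain ⟨Q, hQ⟩ := exists_eval_add P v
  simpa [hQ] using hw (Q * R)

lemma exists_integral_monomial_smul_add {d : ℕ} {w : (Fin d → ℝ) → ℝ}
    (hw : ∀ P : MvPolynomial (Fin d) ℝ, Integrable fun x => MvPolynomial.eval x P * w x)
    (c a : ℝ) (k : ℕ) (s : Fin d →₀ ℕ) (hs : s.degree ≤ k) (R : MvPolynomial (Fin d) ℝ) :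
    ∃ L : (Fin d → ℝ) → ℝ, IsPolyOfDeg d (k - 1) L ∧ (k = 0 → L = 0) ∧
      ∀ x, ∫ g, MvPolynomial.eval (c • x + g) (MvPolynomial.monomial s a) *
          MvPolynomial.eval g R * w g =
        c ^ k * MvPolynomial.eval x (MvPolynomial.monomial s a) *
          (∫ g, MvPolynomial.eval g R * w g) + L x := by
  have hconst (k : ℕ) (R : MvPolynomial (Fin d) ℝ) :
      ∃ L : (Fin d → ℝ) → ℝ, IsPolyOfDeg d (k - 1) L ∧ (k = 0 → L = 0) ∧
      ∀ x, ∫ g, MvPolynomial.eval (c • x + g) (MvPolynomial.monomial 0 a) *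
          MvPolynomial.eval g R * w g =
        c ^ k * MvPolynomial.eval x (MvPolynomial.monomial 0 a) *
          (∫ g, MvPolynomial.eval g R * w g) + L x := by
    refine ⟨fun _ => (1 - c ^ k) * a * ∫ g, MvPolynomial.eval g R * w g, .const _ _ _, ?_,
      fun x => ?_⟩
    · rintro rfl
      funext x
      simp
    · simp only [MvPolynomial.eval_monomial, Finsupp.prod_zero_index, mul_one, mul_assoc]
      rw [integral_const_mul]
      ring
  induction k generalizing s R with
  | zero =>
    obtain rfl : s = 0 := (Finsupp.degree_eq_zero_iff s).mp (Nat.le_zero.mp hs)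
    exact hconst 0 R
  | succ k ih =>
    by_cases hs0 : s = 0
    · subst hs0
      exact hconst (k + 1) R
    obtain ⟨i, hi⟩ := Finsupp.ne_iff.mp hs0
    obtain ⟨s', rfl⟩ : ∃ s', s = s' + Finsupp.single i 1 :=
      ⟨s - Finsupp.single i 1, (tsub_add_cancel_of_le (by
        rw [Finsupp.single_le_iff]; simp at hi; omega)).symm⟩
    have hs' : s'.degree ≤ k := by simpa using hs
    have hmon (x : Fin d → ℝ) : MvPolynomial.eval x
        (MvPolynomial.monomial (s' + Finsupp.single i 1) a) =
        x i * MvPolynomial.eval x (MvPolynomial.monomial s' a) := by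
      rw [← mul_one a, ← MvPolynomial.monomial_mul, mul_one, map_mul, mul_comm]
      simp [MvPolynomial.eval_monomial]
    obtain ⟨L₁, hL₁, hL₁0, h₁⟩ := ih s' hs' R
    obtain ⟨L₂, hL₂, -, h₂⟩ := ih s' hs' (MvPolynomial.X i * R)
    refine ⟨fun x => c * (x i * L₁ x) + (c ^ k * (∫ g, MvPolynomial.eval g (MvPolynomial.X i * R) *
      w g) * MvPolynomial.eval x (MvPolynomial.monomial s' a) + L₂ x), ?_, by simp, fun x => ?_⟩
    · rw [Nat.add_sub_cancel]
      refine .add (.const_mul ?_ c) (.add (.const_mul ?_ _) (hL₂.mono (Nat.sub_le _ _)))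
      · rcases Nat.eq_zero_or_pos k with h0 | h0
        · simpa [hL₁0 h0] using IsPolyOfDeg.const d k 0
        · simpa [Nat.sub_add_cancel h0] using hL₁.coord_mul i
      · refine ⟨_, ?_, fun x => rfl⟩
        exact (MvPolynomial.totalDegree_monomial_le _ _).trans hs'
    · have hsplit (g : Fin d → ℝ) : MvPolynomial.eval (c • x + g)
          (MvPolynomial.monomial (s' + Finsupp.single i 1) a) * MvPolynomial.eval g R * w g =
          c * x i * (MvPolynomial.eval (c • x + g) (MvPolynomial.monomial s' a) *
            MvPolynomial.eval g R * w g) +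
          MvPolynomial.eval (c • x + g) (MvPolynomial.monomial s' a) *
            MvPolynomial.eval g (MvPolynomial.X i * R) * w g := by
        rw [hmon]
        simp only [Pi.add_apply, Pi.smul_apply, smul_eq_mul, map_mul, MvPolynomial.eval_X]
        ring
      simp_rw [hsplit]
      rw [integral_add ((integrable_eval_add_mul_mul hw _ _ _).const_mul _)
        (integrable_eval_add_mul_mul hw _ _ _), integral_const_mul, h₁, h₂, hmon]
      ring

lemma IsPolyOfDeg.exists_integral_smul_add {d k : ℕ} {q : (Fin d → ℝ) → ℝ}
    (hq : IsPolyOfDeg d k q) {w : (Fin d → ℝ) → ℝ}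
    (hw : ∀ P : MvPolynomial (Fin d) ℝ, Integrable fun x => MvPolynomial.eval x P * w x)
    (hw1 : ∫ g, w g = 1) (c : ℝ) :
    ∃ L : (Fin d → ℝ) → ℝ, IsPolyOfDeg d (k - 1) L ∧ (k = 0 → L = 0) ∧
      ∀ x, ∫ g, q (c • x + g) * w g = c ^ k * q x + L x := by
  obtain ⟨P, hP, hq⟩ := hq
  have h (m : P.support) := exists_integral_monomial_smul_add hw c (P.coeff m.1) k m.1
    ((MvPolynomial.le_totalDegree m.2).trans hP) 1
  choose L hL hL0 heq using h
  refine ⟨fun x => ∑ m, L m x, .sum _ fun m _ => hL m, fun hk => ?_, fun x => ?_⟩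
  · funext x
    simp [hL0 _ hk]
  · have hev (y : Fin d → ℝ) : q y = ∑ m : P.support,
        MvPolynomial.eval y (MvPolynomial.monomial m.1 (P.coeff m.1)) := by
      rw [hq, ← map_sum, Finset.univ_eq_attach,
        Finset.sum_attach P.support fun m => MvPolynomial.monomial m (P.coeff m), ← P.as_sum]
    simp_rw [hev, Finset.sum_mul, Finset.mul_sum]
    rw [integral_finsetSum, ← Finset.sum_add_distrib]
    · refine Finset.sum_congr rfl fun m _ => ?_
      simpa [hw1] using heq m x
    · intro m _
      simpa using integrable_eval_add_mul_mul hw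
        (MvPolynomial.monomial m.1 (P.coeff m.1)) 1 (c • x)

lemma integrable_mul_heatKer_sub_smul {d : ℕ} {A : Matrix (Fin d) (Fin d) ℝ} (hA : A.PosDef)
    {t : ℝ} (ht : 0 < t) {h : (Fin d → ℝ) → ℝ} (hh : Integrable h) (c : ℝ) :
    Integrable (fun p : (Fin d → ℝ) × (Fin d → ℝ) => h p.1 * heatKer d A (p.2 - c • p.1) t)
      (volume.prod volume) := by
  have hcont := continuous_heatKer A t
  have hmeas : AEStronglyMeasurable
      (fun p : (Fin d → ℝ) × (Fin d → ℝ) => h p.1 * heatKer d A (p.2 - c • p.1) t)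
      (volume.prod volume) :=
    hh.aestronglyMeasurable.comp_fst.mul (Continuous.aestronglyMeasurable (by fun_prop))
  rw [integrable_prod_iff hmeas]
  refine ⟨.of_forall fun x => ((integrable_heatKer hA ht).comp_sub_right (c • x)).const_mul (h x), ?_⟩
  refine hh.norm.congr (.of_forall fun x => ?_)
  simp_rw [norm_mul, Real.norm_of_nonneg (heatKer_nonneg hA ht _)]
  rw [integral_const_mul, integral_sub_right_eq_self (fun y => heatKer d A y t),
    integral_heatKer hA ht, mul_one]

lemma IsPolyOfDeg.integrable_mul_heatKer {d k : ℕ} {A : Matrix (Fin d) (Fin d) ℝ}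
    (hA : A.PosDef) {t : ℝ} (ht : 0 < t) {q : (Fin d → ℝ) → ℝ} (hq : IsPolyOfDeg d k q) :
    Integrable fun x => q x * heatKer d A x t := by
  obtain ⟨P, -, hq⟩ := hq
  simp_rw [hq]
  exact integrable_eval_mul_heatKer hA ht P

lemma IsPolyOfDeg.sq {d k : ℕ} {q : (Fin d → ℝ) → ℝ} (hq : IsPolyOfDeg d k q) :
    IsPolyOfDeg d (2 * k) fun x => q x ^ 2 := by
  obtain ⟨P, hP, hq⟩ := hq
  exact ⟨P ^ 2, (MvPolynomial.totalDegree_pow _ _).trans (by gcongr), fun x => by simp [hq]⟩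

lemma IsPolyOfDeg.comp_add_left {d k : ℕ} {q : (Fin d → ℝ) → ℝ} (hq : IsPolyOfDeg d k q)
    (v : Fin d → ℝ) : ∃ l, IsPolyOfDeg d l fun x => q (v + x) := by
  obtain ⟨P, -, hq⟩ := hq
  obtain ⟨Q, hQ⟩ := exists_eval_add P v
  exact ⟨_, Q, le_rfl, fun x => (hq _).trans (hQ x)⟩

lemma IsPolyOfDeg.integrable_mul_heatKer_sub {d k : ℕ} {A : Matrix (Fin d) (Fin d) ℝ}
    (hA : A.PosDef) {t : ℝ} (ht : 0 < t) {q : (Fin d → ℝ) → ℝ} (hq : IsPolyOfDeg d k q)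
    (v : Fin d → ℝ) : Integrable fun x => q x * heatKer d A (x - v) t := by
  obtain ⟨l, hl⟩ := hq.comp_add_left v
  simpa using (hl.integrable_mul_heatKer hA ht).comp_sub_right v

/-- Averaging against a heat kernel centred at `c • x` acts on polynomials of degree at most `k`
as multiplication by `c ^ k`, up to a polynomial of lower degree. -/
lemma IsPolyOfDeg.exists_integral_mul_heatKer_sub_smul {d k : ℕ}
    {A : Matrix (Fin d) (Fin d) ℝ} (hA : A.PosDef) {t : ℝ} (ht : 0 < t)
    {q : (Fin d → ℝ) → ℝ} (hq : IsPolyOfDeg d k q) (c : ℝ) :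
    ∃ L : (Fin d → ℝ) → ℝ, IsPolyOfDeg d (k - 1) L ∧ (k = 0 → L = 0) ∧
      ∀ x, ∫ y, q y * heatKer d A (y - c • x) t = c ^ k * q x + L x := by
  obtain ⟨L, hL, hL0, h⟩ := hq.exists_integral_smul_add
    (integrable_eval_mul_heatKer hA ht) (integral_heatKer hA ht) c
  refine ⟨L, hL, hL0, fun x => ?_⟩
  rw [← h, ← integral_add_left_eq_self _ (c • x)]
  simp

lemma sq_integral_mul_heatKer_sub_le {d k : ℕ} {A : Matrix (Fin d) (Fin d) ℝ} (hA : A.PosDef)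
    {t : ℝ} (ht : 0 < t) {q : (Fin d → ℝ) → ℝ} (hq : IsPolyOfDeg d k q) (v : Fin d → ℝ) :
    (∫ y, q y * heatKer d A (y - v) t) ^ 2 ≤ ∫ y, q y ^ 2 * heatKer d A (y - v) t := by
  set m := ∫ y, q y * heatKer d A (y - v) t with hm
  have h1 : ∫ y, heatKer d A (y - v) t = 1 := by
    rw [integral_sub_right_eq_self (fun y => heatKer d A y t), integral_heatKer hA ht]
  have hi0 : Integrable fun y => heatKer d A (y - v) t := (integrable_heatKer hA ht).comp_sub_right v
  have hi1 := hq.integrable_mul_heatKer_sub hA ht v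
  have hi2 := hq.sq.integrable_mul_heatKer_sub hA ht v
  have h0 : 0 ≤ ∫ y, (q y - m) ^ 2 * heatKer d A (y - v) t :=
    integral_nonneg fun y => mul_nonneg (sq_nonneg _) (heatKer_nonneg hA ht _)
  have h2 (y : Fin d → ℝ) : (q y - m) ^ 2 * heatKer d A (y - v) t =
      q y ^ 2 * heatKer d A (y - v) t - 2 * m * (q y * heatKer d A (y - v) t) +
        m ^ 2 * heatKer d A (y - v) t := by ring
  have hi21 : Integrable fun y => q y ^ 2 * heatKer d A (y - v) t -
      2 * m * (q y * heatKer d A (y - v) t) := hi2.sub (hi1.const_mul _)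
  simp_rw [h2] at h0
  rw [integral_add hi21 (hi0.const_mul _), integral_sub hi2 (hi1.const_mul _), integral_const_mul, integral_const_mul, h1, ← hm] at h0
  linarith

lemma integrable_mul_heatKer_mul_heatKer_sub {d : ℕ} {A : Matrix (Fin d) (Fin d) ℝ}
    (hA : A.PosDef) {s r : ℝ} (hr : 0 < r) {f : (Fin d → ℝ) → ℝ}
    (hf : Integrable fun y => f y * heatKer d A y s) :
    Integrable (fun p : (Fin d → ℝ) × (Fin d → ℝ) =>
      f p.2 * (heatKer d A p.2 s * heatKer d A (p.1 - p.2) r)) (volume.prod volume) := by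
  simpa [Function.comp_def, mul_assoc] using (integrable_mul_heatKer_sub_smul hA hr hf 1).swap

lemma integral_sq_integral_mul_heatKer_sub_le {d k : ℕ} {A : Matrix (Fin d) (Fin d) ℝ}
    (hA : A.PosDef) {s r : ℝ} (hr : 0 < r) (hrs : r ≤ s) {q : (Fin d → ℝ) → ℝ}
    (hq : IsPolyOfDeg d k q) :
    ∫ x, (∫ y, q y * heatKer d A (y - (s / (s + r)) • x) (s * r / (s + r))) ^ 2 *
        heatKer d A x (s + r) ≤
      2 ^ ((d : ℝ) / 2) * ∫ x, q x ^ 2 * heatKer d A x (s + r) := by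
  have hs : 0 < s := hr.trans_le hrs
  have hτ : 0 < s * r / (s + r) := by positivity
  have hK := integrable_mul_heatKer_mul_heatKer_sub hA hr (hq.sq.integrable_mul_heatKer hA hs)
  have hpoly : ∃ l, IsPolyOfDeg d l fun x =>
      ∫ y, q y * heatKer d A (y - (s / (s + r)) • x) (s * r / (s + r)) := by
    obtain ⟨L, hL, -, h⟩ := hq.exists_integral_mul_heatKer_sub_smul hA hτ (s / (s + r))
    simp_rw [h]
    exact ⟨k, (hq.const_mul _).add (hL.mono (Nat.sub_le _ _))⟩
  obtain ⟨l, hl⟩ := hpoly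
  calc _ ≤ ∫ x, ∫ y, q y ^ 2 * (heatKer d A y s * heatKer d A (x - y) r) := by
        refine integral_mono (hl.sq.integrable_mul_heatKer hA (by positivity))
          hK.integral_prod_left fun x => ?_
        have h1 := sq_integral_mul_heatKer_sub_le hA hτ hq ((s / (s + r)) • x)
        have h2 (y : Fin d → ℝ) : q y ^ 2 * (heatKer d A y s * heatKer d A (x - y) r) =
            q y ^ 2 * heatKer d A (y - (s / (s + r)) • x) (s * r / (s + r)) *
              heatKer d A x (s + r) := by
          rw [heatKer_mul_heatKer A hs hr]
          ring
        simp_rw [h2]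
        rw [integral_mul_const]
        exact mul_le_mul_of_nonneg_right h1 (heatKer_nonneg hA (by positivity) x)
    _ = ∫ y, ∫ x, q y ^ 2 * (heatKer d A y s * heatKer d A (x - y) r) :=
        integral_integral_swap hK
    _ = ∫ y, q y ^ 2 * heatKer d A y s := by
        congr 1 with y
        rw [integral_const_mul, integral_const_mul,
          integral_sub_right_eq_self (fun x => heatKer d A x r), integral_heatKer hA hr, mul_one]
    _ ≤ ∫ y, 2 ^ ((d : ℝ) / 2) * (q y ^ 2 * heatKer d A y (s + r)) := by
        refine integral_mono (hq.sq.integrable_mul_heatKer hA hs)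
          ((hq.sq.integrable_mul_heatKer hA (by positivity)).const_mul _) fun y => ?_
        have := heatKer_le_of_le hA hs (t := s + r) (by linarith) (by linarith) y
        have h3 := mul_le_mul_of_nonneg_left this (sq_nonneg (q y))
        simp only
        linarith
    _ = _ := integral_const_mul _ _

lemma integral_sq_add_mul_heatKer_le {d k l : ℕ} {A : Matrix (Fin d) (Fin d) ℝ}
    (hA : A.PosDef) {t : ℝ} (ht : 0 < t) {p q : (Fin d → ℝ) → ℝ} (hp : IsPolyOfDeg d k p)
    (hq : IsPolyOfDeg d l q) (a : ℝ) :
    ∫ x, (p x + a * q x) ^ 2 * heatKer d A x t ≤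
      2 * (∫ x, p x ^ 2 * heatKer d A x t) + 2 * a ^ 2 * ∫ x, q x ^ 2 * heatKer d A x t := by
  have hp2 := hp.sq.integrable_mul_heatKer hA ht
  have hq2 := hq.sq.integrable_mul_heatKer hA ht
  have hpq := ((hp.mono (le_max_left k l)).add
    ((hq.mono (le_max_right k l)).const_mul a)).sq.integrable_mul_heatKer hA ht
  rw [← integral_const_mul, ← integral_const_mul, ← integral_add (hp2.const_mul _)
    (hq2.const_mul _)]
  refine integral_mono hpq ((hp2.const_mul _).add (hq2.const_mul _)) fun x => ?_
  have h0 := heatKer_nonneg hA ht x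
  have h1 : (p x + a * q x) ^ 2 ≤ 2 * p x ^ 2 + 2 * a ^ 2 * q x ^ 2 := by
    nlinarith [sq_nonneg (p x - a * q x)]
  simp only
  nlinarith [mul_le_mul_of_nonneg_right h1 h0]

lemma exists_bounded_preimage_of_heatKer_average (d k : ℕ) :
    ∃ C : ℝ, 0 < C ∧ ∀ A : Matrix (Fin d) (Fin d) ℝ, A.PosDef →
      ∀ s r : ℝ, 0 < r → r ≤ s → ∀ q : (Fin d → ℝ) → ℝ, IsPolyOfDeg d k q →
      ∃ qt : (Fin d → ℝ) → ℝ, IsPolyOfDeg d k qt ∧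
        ∫ x, qt x ^ 2 * heatKer d A x (s + r) ≤ C * ∫ x, q x ^ 2 * heatKer d A x (s + r) ∧
        ∀ x, ∫ y, qt y * heatKer d A (y - (s / (s + r)) • x) (s * r / (s + r)) = q x := by
  induction k with
  | zero =>
    refine ⟨1, one_pos, fun A hA s r hr hrs q hq => ⟨q, hq, by simp, fun x => ?_⟩⟩
    have hs : 0 < s := hr.trans_le hrs
    obtain ⟨L, -, hL0, h⟩ := hq.exists_integral_mul_heatKer_sub_smul hA
      (t := s * r / (s + r)) (by positivity) (s / (s + r))
    rw [h, hL0 rfl]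
    simp
  | succ k ih =>
    obtain ⟨C, hC, ih⟩ := ih
    set B : ℝ := 2 ^ ((d : ℝ) / 2) with hB
    have hB0 : 0 < B := by positivity
    set D : ℝ := ((2 : ℝ) ^ (k + 1)) ^ 2 with hD
    have hD0 : 0 < D := by positivity
    refine ⟨2 * (C * (2 + 2 * D * B)) + 2 * D, by positivity, fun A hA s r hr hrs q hq => ?_⟩
    have hs : 0 < s := hr.trans_le hrs
    have hsr : 0 < s + r := by positivity
    have hτ : 0 < s * r / (s + r) := by positivity
    obtain ⟨L, hL, -, h⟩ := hq.exists_integral_mul_heatKer_sub_smul hA hτ (s / (s + r))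
    have hT := integral_sq_integral_mul_heatKer_sub_le hA hr hrs hq
    simp_rw [h] at hT
    set a : ℝ := ((s / (s + r)) ^ (k + 1))⁻¹ with ha
    have ha1 : a * (s / (s + r)) ^ (k + 1) = 1 := inv_mul_cancel₀ (by positivity)
    have haD : a ^ 2 ≤ D := by
      rw [ha, hD, ← inv_pow, inv_div]
      have : (s + r) / s ≤ 2 := by rw [div_le_iff₀ hs]; linarith
      gcongr
    have hTq : IsPolyOfDeg d (k + 1) fun x => (s / (s + r)) ^ (k + 1) * q x + L x :=
      (hq.const_mul _).add (hL.mono (by simp))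
    obtain ⟨pt, hpt, hbound, hpre⟩ := ih A hA s r hr hrs (fun x => -a * L x) (hL.const_mul _)
    have hp := integral_sq_add_mul_heatKer_le hA hsr hq hTq (-a)
    have hp' (x : Fin d → ℝ) : q x + -a * ((s / (s + r)) ^ (k + 1) * q x + L x) = -a * L x := by
      linear_combination -q x * ha1
    simp_rw [hp'] at hp
    refine ⟨fun x => pt x + a * q x, (hpt.mono (Nat.le_succ k)).add (hq.const_mul a), ?_,
      fun x => ?_⟩
    · have hN0 : 0 ≤ ∫ x, q x ^ 2 * heatKer d A x (s + r) :=
        integral_nonneg fun x => mul_nonneg (sq_nonneg _) (heatKer_nonneg hA hsr x)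
      refine (integral_sq_add_mul_heatKer_le hA hsr hpt hq a).trans ?_
      set N := ∫ x, q x ^ 2 * heatKer d A x (s + r)
      have h1 : ∫ x, (-a * L x) ^ 2 * heatKer d A x (s + r) ≤ (2 + 2 * D * B) * N := by
        refine hp.trans ?_
        have h2 : 2 * (-a) ^ 2 * ∫ x, ((s / (s + r)) ^ (k + 1) * q x + L x) ^ 2 *
            heatKer d A x (s + r) ≤ 2 * D * (B * N) := by
          rw [neg_sq]
          gcongr
          exact integral_nonneg fun x => mul_nonneg (sq_nonneg _) (heatKer_nonneg hA hsr x)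
        linarith
      calc _ ≤ 2 * (C * ((2 + 2 * D * B) * N)) + 2 * D * N := by
            gcongr
            exact hbound.trans (by gcongr)
        _ = _ := by ring
    · simp_rw [add_mul, mul_assoc]
      rw [integral_add (hpt.integrable_mul_heatKer_sub hA hτ _)
        ((hq.integrable_mul_heatKer_sub hA hτ _).const_mul _), integral_const_mul, hpre, h]
      linear_combination q x * ha1

lemma integral_mul_mul_heatKer_eq_of_preimage {d k : ℕ} {A : Matrix (Fin d) (Fin d) ℝ}
    (hA : A.PosDef) {s r : ℝ} (hs : 0 < s) (hr : 0 < r) {q qt : (Fin d → ℝ) → ℝ}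
    (hqt : IsPolyOfDeg d k qt)
    (hpre : ∀ x, ∫ y, qt y * heatKer d A (y - (s / (s + r)) • x) (s * r / (s + r)) = q x)
    {F : (Fin d → ℝ) → ℝ} (hF : Measurable F)
    (hF2 : Integrable fun x => F x ^ 2 * heatKer d A x (s + r)) :
    ∫ x, F x * q x * heatKer d A x (s + r) =
      ∫ y, heatKer d A y s * qt y * ∫ x, heatKer d A (x - y) r * F x := by
  have hτ : 0 < s * r / (s + r) := by positivity
  have hcs := continuous_heatKer A s
  have hcr := continuous_heatKer A r
  have hcq := hqt.continuous
  have hK1 : Integrable (fun p : (Fin d → ℝ) × (Fin d → ℝ) =>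
      F p.1 ^ 2 * (heatKer d A p.2 s * heatKer d A (p.1 - p.2) r)) (volume.prod volume) := by
    simpa only [heatKer_mul_heatKer A hs hr, mul_assoc] using
      integrable_mul_heatKer_sub_smul hA hτ hF2 (s / (s + r))
  have hK2 := integrable_mul_heatKer_mul_heatKer_sub hA hr (hqt.sq.integrable_mul_heatKer hA hs)
  have hK : Integrable (fun p : (Fin d → ℝ) × (Fin d → ℝ) =>
      F p.1 * qt p.2 * (heatKer d A p.2 s * heatKer d A (p.1 - p.2) r)) (volume.prod volume) := by
    refine (hK1.add hK2).mono' (Measurable.aestronglyMeasurable (by fun_prop))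
      (.of_forall fun p => ?_)
    have h0 : 0 ≤ heatKer d A p.2 s * heatKer d A (p.1 - p.2) r :=
      mul_nonneg (heatKer_nonneg hA hs _) (heatKer_nonneg hA hr _)
    have h1 : |F p.1 * qt p.2| ≤ F p.1 ^ 2 + qt p.2 ^ 2 := by
      rw [abs_le]
      constructor <;> nlinarith [sq_nonneg (F p.1 + qt p.2), sq_nonneg (F p.1 - qt p.2)]
    rw [norm_mul, Real.norm_of_nonneg h0, Real.norm_eq_abs, Pi.add_apply, ← add_mul]
    gcongr
  calc _ = ∫ x, ∫ y, F x * qt y * (heatKer d A y s * heatKer d A (x - y) r) := by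
        congr 1 with x
        rw [← hpre x, mul_right_comm, ← integral_const_mul]
        congr 1 with y
        rw [heatKer_mul_heatKer A hs hr]
        ring
    _ = ∫ y, ∫ x, F x * qt y * (heatKer d A y s * heatKer d A (x - y) r) :=
        integral_integral_swap hK
    _ = _ := by
        congr 1 with y
        rw [← integral_const_mul]
        congr 1 with x
        ring

/-- For `d ≥ 1`, `k ≥ 0`, `Λ ≥ 1` there is `C(k,d,Λ) < ∞` such that: for every real
symmetric matrix `ā` with eigenvalues in `[1,Λ]`, every polynomial `q` of total degree at
most `k` and radii `1 ≤ r ≤ R/√2`, there is a polynomial `q̃` of total degree at most `k`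
with `‖q̃‖_{L²(Φ_R)} ≤ C ‖q‖_{L²(Φ_R)}`, and for every measurable `F` with
`∫ |F|² Φ_R < ∞`:
`∫ F(x) q(x) Φ_R(x) dx = ∫ Φ_{√(R²−r²)}(y) q̃(y) (∫ Φ(x−y,r²) F(x) dx) dy`,
where `Φ_ρ(x) = Φ(x, ρ²)` is the heat kernel of `ā`. -/
theorem stmt_15 (d k : ℕ) (hd : 1 ≤ d) (Λ : ℝ) (hΛ : 1 ≤ Λ) :
    ∃ C : ℝ, 0 < C ∧
      ∀ A : Matrix (Fin d) (Fin d) ℝ, A.IsSymm →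
        (∀ ξ : Fin d → ℝ,
          (∑ i, ξ i ^ 2) ≤ ξ ⬝ᵥ A.mulVec ξ ∧ ξ ⬝ᵥ A.mulVec ξ ≤ Λ * ∑ i, ξ i ^ 2) →
      ∀ q : (Fin d → ℝ) → ℝ, IsPolyOfDeg d k q →
      ∀ r R : ℝ, 1 ≤ r → r ≤ R / Real.sqrt 2 →
      ∃ qt : (Fin d → ℝ) → ℝ, IsPolyOfDeg d k qt ∧
        Real.sqrt (∫ x : Fin d → ℝ, (qt x) ^ 2 * heatKer d A x (R ^ 2)) ≤
          C * Real.sqrt (∫ x : Fin d → ℝ, (q x) ^ 2 * heatKer d A x (R ^ 2)) ∧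
        ∀ F : (Fin d → ℝ) → ℝ, Measurable F →
          (∫⁻ x : Fin d → ℝ, ENNReal.ofReal ((F x) ^ 2 * heatKer d A x (R ^ 2))) < ⊤ →
          (∫ x : Fin d → ℝ, F x * q x * heatKer d A x (R ^ 2)) =
            ∫ y : Fin d → ℝ, heatKer d A y (R ^ 2 - r ^ 2) * qt y *
              (∫ x : Fin d → ℝ, heatKer d A (x - y) (r ^ 2) * F x) := by
  obtain ⟨C, hC, hpre⟩ := exists_bounded_preimage_of_heatKer_average d k
  refine ⟨Real.sqrt C, Real.sqrt_pos.mpr hC, fun A hsymm hbd q hq r R hr hrR => ?_⟩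
  have hA : A.PosDef := by
    refine .of_dotProduct_mulVec_pos hsymm fun x hx => ?_
    obtain ⟨i, hi⟩ := Function.ne_iff.mp hx
    have h1 : 0 < ∑ i, x i ^ 2 :=
      Finset.sum_pos' (fun i _ => sq_nonneg _) ⟨i, Finset.mem_univ i, by
        have : x i ≠ 0 := hi
        positivity⟩
    simpa using h1.trans_le (hbd x).1
  have hr2 : 0 < r ^ 2 := by positivity
  have hrs : r ^ 2 ≤ R ^ 2 - r ^ 2 := by
    rw [le_div_iff₀ (by positivity)] at hrR
    have h1 : (r * Real.sqrt 2) ^ 2 ≤ R ^ 2 := by gcongr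
    rw [mul_pow, Real.sq_sqrt zero_le_two] at h1
    linarith
  have hsum : R ^ 2 - r ^ 2 + r ^ 2 = R ^ 2 := by ring
  obtain ⟨qt, hqt, hbound, hT⟩ := hpre A hA (R ^ 2 - r ^ 2) (r ^ 2) hr2 hrs q hq
  refine ⟨qt, hqt, ?_, fun F hF hF2 => ?_⟩
  · rw [← Real.sqrt_mul hC.le]
    rw [hsum] at hbound
    exact Real.sqrt_le_sqrt hbound
  · have hs : 0 < R ^ 2 - r ^ 2 := hr2.trans_le hrs
    have hcont := continuous_heatKer A (R ^ 2)
    have hF2' : Integrable fun x => F x ^ 2 * heatKer d A x (R ^ 2) := by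
      refine ⟨Measurable.aestronglyMeasurable (by fun_prop), ?_⟩
      rwa [hasFiniteIntegral_iff_ofReal (.of_forall fun x =>
        mul_nonneg (sq_nonneg _) (heatKer_nonneg hA (by linarith) x))]
    have := integral_mul_mul_heatKer_eq_of_preimage hA hs hr2 hqt hT hF (by rwa [hsum])
    rwa [hsum] at this
end

section
/- Let d ≥ 1 be an integer. For every Schwartz function f : ℝ^d → ℝ with ∫_{ℝ^d} f(x) dx = 0, there exist Schwartz functions F₁, …, F_d : ℝ^d → ℝ such that Σ_{i=1}^d ∂_{x_i} F_i = f on ℝ^d. -/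
open MeasureTheory

open scoped ContDiff SchwartzMap FourierTransform LineDeriv Convolution

/-- The inverse of a function of temperate growth that is bounded below by `1` has temperate
growth. -/
theorem Function.HasTemperateGrowth.inv_of_one_le {E : Type*} [NormedAddCommGroup E]
    [NormedSpace ℝ E] {f : E → ℝ} (hf : f.HasTemperateGrowth) (h : ∀ x, 1 ≤ f x) :
    (fun x ↦ (f x)⁻¹).HasTemperateGrowth := by
  set t : Set ℝ := Set.Ioi (1 / 2)
  have ht : UniqueDiffOn ℝ t := isOpen_Ioi.uniqueDiffOn
  have hne : ∀ x ∈ t, x ≠ 0 := fun x hx ↦ (lt_trans (by norm_num) (Set.mem_Ioi.1 hx)).ne'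
  refine Function.HasTemperateGrowth.comp' (g := fun y : ℝ ↦ y⁻¹) (t := t) ?_ ht
    (contDiffOn_id.inv hne) (fun N ↦ ⟨0, N.factorial * 2 ^ (N + 1), by positivity, ?_⟩) hf
  · rintro _ ⟨x, rfl⟩
    exact lt_of_lt_of_le (by norm_num) (h x)
  · intro n hn x hx
    have hx0 : 0 < x := lt_trans (by norm_num) (Set.mem_Ioi.1 hx)
    have hx2 : x⁻¹ ≤ 2 := by
      rw [inv_le_comm₀ hx0 two_pos]
      exact (by simpa [t] using hx : (2 : ℝ)⁻¹ < x).le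
    rw [norm_iteratedFDerivWithin_eq_norm_iteratedDerivWithin,
      iteratedDerivWithin_eq_iteratedDeriv ht (contDiffAt_inv ℝ (hne x hx)) hx,
      iteratedDeriv_eq_iterate, iter_deriv_inv]
    have hz : x ^ (-1 - n : ℤ) = x⁻¹ ^ (n + 1) := by
      rw [inv_pow, ← zpow_natCast, ← zpow_neg]
      congr 1
      push_cast
      ring
    rw [hz, norm_mul, norm_mul, norm_pow, norm_neg, norm_one, one_pow, one_mul, pow_zero, mul_one,
      Real.norm_natCast, norm_pow, norm_inv, Real.norm_of_nonneg hx0.le]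
    gcongr
    calc x⁻¹ ^ (n + 1) ≤ 2 ^ (n + 1) := by gcongr
      _ ≤ 2 ^ (N + 1) := by gcongr; norm_num

/-- The average of a smooth function over the segment from the origin to `x` is smooth in `x`. -/
theorem ContDiff.integral_comp_smul {E F : Type*} [NormedAddCommGroup E] [NormedSpace ℝ E]
    [NormedAddCommGroup F] [NormedSpace ℝ F] {h : E → F} (hh : ContDiff ℝ ∞ h) :
    ContDiff ℝ ∞ (fun x ↦ ∫ t in (0 : ℝ)..1, h (t • x)) := by
  let φ : ContDiffBump (0 : ℝ) := ⟨1, 2, one_pos, one_lt_two⟩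
  let g : E → ℝ → F := fun x s ↦ φ s • h ((-s) • x)
  have hg : ContDiff ℝ ∞ ↿g := by
    refine (φ.contDiff.comp contDiff_snd).smul (hh.comp ?_)
    exact contDiff_snd.neg.smul contDiff_fst
  have key := contDiffOn_convolution_right_with_param_comp (𝕜 := ℝ) (μ := volume) (n := ⊤)
    (ContinuousLinearMap.lsmul ℝ ℝ : ℝ →L[ℝ] F →L[ℝ] F) (v := fun _ : E ↦ (0 : ℝ))
    contDiffOn_const (f := (Set.Ioc (0 : ℝ) 1).indicator 1) (g := g) isOpen_univ
    (isCompact_closedBall (0 : ℝ) 2) (fun x s _ hs ↦ ?_) ?_ hg.contDiffOn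
  · rw [contDiffOn_univ] at key
    convert key using 2 with x
    rw [intervalIntegral.integral_of_le zero_le_one, ← integral_indicator measurableSet_Ioc,
      convolution_def]
    refine integral_congr_ae (.of_forall fun t ↦ ?_)
    by_cases ht : t ∈ Set.Ioc (0 : ℝ) 1
    · have : φ (-t) = 1 := φ.one_of_mem_closedBall (by
        simpa [φ, abs_of_pos ht.1] using ht.2)
      simp [ht, g, this]
    · simp [ht]
  · have : φ s = 0 := φ.zero_of_le_dist (by
      simpa [φ] using (not_le.1 (by simpa using hs : ¬ |s| ≤ 2)).le)
    simp [g, this]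
  · exact ((integrable_indicator_iff measurableSet_Ioc).2
      (integrableOn_const (by simp))).locallyIntegrable

/-- Hadamard's lemma: a smooth function vanishing at the origin factors as `x ↦ A x x` with `A`
smooth and linear-map valued. -/
theorem ContDiff.exists_apply_self {E F : Type*} [NormedAddCommGroup E] [NormedSpace ℝ E]
    [NormedAddCommGroup F] [NormedSpace ℝ F] [CompleteSpace F] {g : E → F} (hg : ContDiff ℝ ∞ g)
    (hg0 : g 0 = 0) : ∃ A : E → E →L[ℝ] F, ContDiff ℝ ∞ A ∧ ∀ x, A x x = g x := by
  have hg' : ContDiff ℝ ∞ (fderiv ℝ g) := hg.fderiv_right (by simp)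
  refine ⟨_, hg'.integral_comp_smul, fun x ↦ ?_⟩
  have hc : Continuous fun t : ℝ ↦ fderiv ℝ g (t • x) :=
    hg'.continuous.comp (continuous_id.smul continuous_const)
  rw [ContinuousLinearMap.intervalIntegral_apply (hc.intervalIntegrable _ _)]
  have hd (t : ℝ) : HasDerivAt (fun t : ℝ ↦ g (t • x)) (fderiv ℝ g (t • x) x) t := by
    have h1 : HasDerivAt (fun t : ℝ ↦ t • x) x t := by
      simpa using (hasDerivAt_id t).smul_const x
    exact ((hg.differentiable (by simp)) (t • x)).hasFDerivAt.comp_hasDerivAt t h1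
  rw [intervalIntegral.integral_eq_sub_of_hasDerivAt (fun t _ ↦ hd t)
    ((hc.clm_apply continuous_const).intervalIntegrable _ _)]
  simp [hg0]

/-- A Schwartz function vanishing at the origin lies in the ideal generated by the coordinates. -/
theorem SchwartzMap.exists_sum_coord_mul {ι : Type*} [Fintype ι]
    (g : 𝓢(EuclideanSpace ℝ ι, ℂ)) (hg0 : g 0 = 0) :
    ∃ h : ι → 𝓢(EuclideanSpace ℝ ι, ℂ), ∀ x, ∑ i, (x i : ℂ) * h i x = g x := by
  classical
  obtain ⟨A, hA, hAg⟩ := (g.smooth ⊤).exists_apply_self hg0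
  let b : ContDiffBump (0 : EuclideanSpace ℝ ι) := ⟨1, 2, one_pos, one_lt_two⟩
  have hb : (b : EuclideanSpace ℝ ι → ℝ).HasTemperateGrowth :=
    b.hasCompactSupport.hasTemperateGrowth b.contDiff
  let D : EuclideanSpace ℝ ι → ℝ := fun x ↦ ‖x‖ ^ 2 + b x
  have hD1 (x) : 1 ≤ D x := by
    rcases le_total ‖x‖ 1 with hx | hx
    · have : b x = 1 := b.one_of_mem_closedBall (by simpa [b] using hx)
      simp only [D, this]
      nlinarith [sq_nonneg ‖x‖]
    · have : 0 ≤ b x := b.nonneg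
      simp only [D]
      nlinarith
  have hD : D.HasTemperateGrowth :=
    (Function.hasTemperateGrowth_norm_sq (EuclideanSpace ℝ ι)).add hb
  have hQ : (fun x ↦ (D x)⁻¹).HasTemperateGrowth := hD.inv_of_one_le hD1
  have hcoord (i : ι) : (fun x : EuclideanSpace ℝ ι ↦ x i).HasTemperateGrowth :=
    (EuclideanSpace.proj (𝕜 := ℝ) i : EuclideanSpace ℝ ι →L[ℝ] ℝ).hasTemperateGrowth
  let e (i : ι) : EuclideanSpace ℝ ι := EuclideanSpace.single i 1
  have hcs (i : ι) : HasCompactSupport fun x ↦ b x • A x (e i) :=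
    b.hasCompactSupport.smul_right
  have hsm (i : ι) : ContDiff ℝ ∞ fun x ↦ b x • A x (e i) :=
    b.contDiff.smul (hA.clm_apply contDiff_const)
  refine ⟨fun i ↦ smulLeftCLM ℂ (fun x ↦ (D x)⁻¹)
    (smulLeftCLM ℂ (fun x ↦ x i) g + (hcs i).toSchwartzMap (hsm i)), fun x ↦ ?_⟩
  have hsum : ∑ i, x i • A x (e i) = g x := by
    rw [← hAg x]
    conv_rhs => arg 2; rw [← (EuclideanSpace.basisFun ι ℝ).sum_repr x]
    simp [e]
  have hnorm : ∑ i, x i * x i = ‖x‖ ^ 2 := by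
    simp [EuclideanSpace.norm_sq_eq, ← sq]
  have hDx : (D x : ℂ) ≠ 0 := by exact_mod_cast (zero_lt_one.trans_le (hD1 x)).ne'
  have hterm (i : ι) : (x i : ℂ) * smulLeftCLM ℂ (fun x ↦ (D x)⁻¹)
      (smulLeftCLM ℂ (fun x ↦ x i) g + (hcs i).toSchwartzMap (hsm i)) x =
      (D x : ℂ)⁻¹ * (((x i * x i : ℝ) : ℂ) * g x + b x * (x i • A x (e i))) := by
    rw [smulLeftCLM_apply_apply hQ, add_apply, smulLeftCLM_apply_apply (hcoord i)]
    simp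
    ring
  simp_rw [hterm]
  rw [← Finset.mul_sum, Finset.sum_add_distrib, ← Finset.sum_mul, ← Finset.mul_sum, hsum,
    ← Complex.ofReal_sum, hnorm, ← add_mul, ← Complex.ofReal_add]
  exact inv_mul_cancel_left₀ hDx _

/-- A complex Schwartz function on Euclidean space with integral zero is the divergence of a
Schwartz vector field. -/
theorem SchwartzMap.exists_sum_lineDeriv_eq {ι : Type*} [Fintype ι] [DecidableEq ι]
    (f : 𝓢(EuclideanSpace ℝ ι, ℂ)) (hf : ∫ x, f x = 0) :
    ∃ F : ι → 𝓢(EuclideanSpace ℝ ι, ℂ), ∑ i, ∂_{EuclideanSpace.single i (1 : ℝ)} (F i) = f := by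
  have h0 : 𝓕 f 0 = 0 := by
    rw [fourier_coe, Real.fourier_eq]
    simpa using hf
  obtain ⟨h, hh⟩ := exists_sum_coord_mul (𝓕 f) h0
  have hpi : (2 * Real.pi * Complex.I : ℂ) ≠ 0 := Complex.two_pi_I_ne_zero
  refine ⟨fun i ↦ 𝓕⁻ ((2 * Real.pi * Complex.I : ℂ)⁻¹ • h i), ?_⟩
  have : f = 𝓕⁻ (𝓕 f) := (FourierTransform.fourierInv_fourier_eq f).symm
  rw [this]
  simp_rw [lineDerivOp_fourierInv_eq]
  rw [← FourierTransform.fourierInv_sum]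
  congr 1
  ext x
  rw [← hh x, sum_apply]
  refine Finset.sum_congr rfl fun i _ ↦ ?_
  rw [smul_apply, smulLeftCLM_apply_apply (by fun_prop), smul_apply, smul_comm,
    smul_inv_smul₀ hpi, EuclideanSpace.inner_single_right]
  simp

/-- Let `d ≥ 1`. For every Schwartz function `f : ℝ^d → ℝ` with `∫ f = 0`, there exist
Schwartz functions `F₁, …, F_d : ℝ^d → ℝ` such that `∑ i, ∂_{x_i} F_i = f` on `ℝ^d`. -/
theorem stmt_16 (d : ℕ) (hd : 1 ≤ d) (f : SchwartzMap (Fin d → ℝ) ℝ)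
    (hf : (∫ x : Fin d → ℝ, f x) = 0) :
    ∃ F : Fin d → SchwartzMap (Fin d → ℝ) ℝ,
      ∀ x : Fin d → ℝ, (∑ i, fderiv ℝ (⇑(F i)) x (Pi.single i 1)) = f x := by
  let e := EuclideanSpace.equiv (Fin d) ℝ
  let f' : 𝓢(EuclideanSpace ℝ (Fin d), ℂ) :=
    (SchwartzMap.compCLMOfContinuousLinearEquiv ℝ e f).postcompCLM Complex.ofRealCLM
  have hf' : ∫ x, f' x = 0 := by
    have h1 := (PiLp.volume_preserving_ofLp (Fin d)).integral_comp
      (MeasurableEquiv.toLp 2 (Fin d → ℝ)).symm.measurableEmbedding (fun x ↦ (f x : ℂ))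
    refine Eq.trans h1 ?_
    rw [integral_complex_ofReal, hf, Complex.ofReal_zero]
  obtain ⟨F, hF⟩ := f'.exists_sum_lineDeriv_eq hf'
  refine ⟨fun i ↦ SchwartzMap.compCLMOfContinuousLinearEquiv ℝ e.symm
    ((F i).postcompCLM Complex.reCLM), fun x ↦ ?_⟩
  have hx := congrArg (fun G : 𝓢(EuclideanSpace ℝ (Fin d), ℂ) ↦ (G (e.symm x)).re) hF
  have hfx : (f' (e.symm x)).re = f x := by simp [f']
  rw [hfx, sum_apply, Complex.re_sum] at hx
  rw [← hx]
  refine Finset.sum_congr rfl fun i _ ↦ ?_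
  have hd1 : HasFDerivAt (fun y ↦ (F i (e.symm y)).re)
      (Complex.reCLM ∘L fderiv ℝ (F i) (e.symm x) ∘L (e.symm : (Fin d → ℝ) →L[ℝ] _)) x :=
    Complex.reCLM.hasFDerivAt.comp x (((F i).hasFDerivAt _).comp x e.symm.hasFDerivAt)
  refine (congrArg (fun L : (Fin d → ℝ) →L[ℝ] ℝ ↦ L (Pi.single i 1)) hd1.fderiv).trans ?_
  rfl
end

section
/- Let d ≥ 1 be an integer. For every smooth, compactly supported function f : ℝ^d → ℝ with ∫_{ℝ^d} f(x) dx = 0, there exist smooth, compactly supported functions F₁, …, F_d : ℝ^d → ℝ such that Σ_{i=1}^d ∂_{x_i} F_i = f on ℝ^d; that is, f is the divergence of a smooth compactly supported vector field. -/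
open MeasureTheory

section CompactlySupportedDivergence

open Set Function
open scoped ContDiff

theorem HasCompactSupport.exists_eq_zero_of_le_abs_apply {ι : Type*} [Fintype ι]
    {f : (ι → ℝ) → ℝ} (hf : HasCompactSupport f) :
    ∃ R, 1 ≤ R ∧ ∀ x j, R ≤ |x j| → f x = 0 := by
  obtain ⟨C, hC⟩ := hf.isCompact.isBounded.exists_norm_le
  refine ⟨max 1 (C + 1), le_max_left _ _, fun x j hx => image_eq_zero_of_notMem_tsupport ?_⟩
  intro hmem
  have h₁ := hC x hmem
  have h₂ : |x j| ≤ ‖x‖ := norm_le_pi_norm x j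
  have h₃ := le_max_right 1 (C + 1)
  linarith

theorem HasCompactSupport.of_eq_zero_of_le_abs_apply {ι : Type*} [Fintype ι]
    {f : (ι → ℝ) → ℝ} {R : ℝ} (hR : 0 ≤ R) (hf : ∀ x j, R ≤ |x j| → f x = 0) :
    HasCompactSupport f := by
  refine HasCompactSupport.intro (isCompact_closedBall 0 R) fun x hx => ?_
  by_contra hne
  refine hx ?_
  rw [mem_closedBall_zero_iff, pi_norm_le_iff_of_nonneg hR]
  intro j
  by_contra! hj
  exact hne (hf x j hj.le)

theorem contDiff_update_prod {ι : Type*} [Fintype ι] [DecidableEq ι] (i : ι) {n : WithTop ℕ∞} :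
    ContDiff ℝ n fun p : (ι → ℝ) × ℝ => update p.1 i p.2 := by
  refine contDiff_pi.2 fun j => ?_
  rcases eq_or_ne j i with rfl | hj
  · simpa using contDiff_snd
  · simp only [update_of_ne hj]
    exact (contDiff_apply ℝ ℝ j).comp contDiff_fst

/-- The primitive of a smooth compactly supported function along one coordinate is smooth. -/
theorem contDiff_intervalIntegral_update {ι : Type*} [Fintype ι] [DecidableEq ι]
    {f : (ι → ℝ) → ℝ} (hf : ContDiff ℝ ∞ f) {R : ℝ} (hR : ∀ x j, R ≤ |x j| → f x = 0) (i : ι) :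
    ContDiff ℝ ∞ fun x => ∫ t in (-R)..(x i), f (update x i t) := by
  have hg : ContDiff ℝ ∞ fun p : (ι → ℝ) × ℝ => f (update p.1 i p.2) :=
    hf.comp (contDiff_update_prod i)
  have hzero (x : ι → ℝ) (t : ℝ) (ht : R ≤ |t|) : f (update x i t) = 0 :=
    hR _ i (by simpa using ht)
  have hloc : LocallyIntegrable (indicator (Ici (0 : ℝ)) fun _ => (1 : ℝ)) volume :=
    (locallyIntegrable_const 1).indicator measurableSet_Ici
  have key := contDiffOn_convolution_right_with_param_comp (n := ⊤)
    (ContinuousLinearMap.mul ℝ ℝ) (s := univ) (v := fun x : ι → ℝ => x i)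
    (contDiff_apply ℝ ℝ i).contDiffOn (g := fun x t => f (update x i t)) isOpen_univ
    (isCompact_Icc (a := -R) (b := R))
    (fun x t _ ht => hzero x t (by
      by_contra! h
      exact ht (abs_le.1 h.le))) hloc hg.contDiffOn
  rw [contDiffOn_univ] at key
  convert key using 2 with x
  have hint : Integrable fun t => f (update x i t) := by
    refine Continuous.integrable_of_hasCompactSupport
      (hg.continuous.comp (Continuous.prodMk_right x)) ?_
    refine HasCompactSupport.intro (isCompact_Icc (a := -R) (b := R)) fun t ht => hzero x t ?_
    by_contra! h
    exact ht (abs_le.1 h.le)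
  rw [convolution_eq_swap, ← intervalIntegral.integral_Iic_sub_Iic hint.integrableOn
    hint.integrableOn, setIntegral_eq_zero_of_forall_eq_zero (t := Iic (-R)), sub_zero,
    ← integral_indicator measurableSet_Iic]
  · congr 1 with t
    by_cases ht : t ≤ x i <;> simp [indicator, ht]
  · intro t ht
    exact hzero x t (le_abs.2 (Or.inr (by linarith [mem_Iic.1 ht])))

theorem intervalIntegral_update_eq_integral {ι : Type*} [DecidableEq ι]
    {f : (ι → ℝ) → ℝ} {R : ℝ} (hR : ∀ x j, R ≤ |x j| → f x = 0) (x : ι → ℝ) (i : ι)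
    {b : ℝ} (hb : R ≤ b) :
    ∫ t in (-R)..b, f (update x i t) = ∫ t, f (update x i t) := by
  refine intervalIntegral.integral_eq_integral_of_support_subset fun t ht => ?_
  have h : |t| < R := by
    by_contra! h
    exact ht (hR _ i (by simpa using h))
  rw [abs_lt] at h
  exact ⟨h.1, h.2.le.trans hb⟩

theorem Real.smoothTransition.integral_deriv : ∫ t, deriv Real.smoothTransition t = 1 := by
  have hd : ContDiff ℝ 1 Real.smoothTransition := Real.smoothTransition.contDiff
  rw [← intervalIntegral.integral_eq_integral_of_support_subset (a := 0) (b := 1),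
    intervalIntegral.integral_deriv_eq_sub
      (fun t _ => (hd.differentiable one_ne_zero).differentiableAt)
      ((hd.continuous_deriv le_rfl).intervalIntegrable _ _)]
  · simp
  · intro t ht
    by_contra h
    refine ht ?_
    rcases le_or_gt t 0 with h0 | h0
    · refine IsLocalMin.deriv_eq_zero (Filter.Eventually.of_forall fun y => ?_)
      rw [Real.smoothTransition.zero_of_nonpos h0]
      exact Real.smoothTransition.nonneg y
    · refine IsLocalMax.deriv_eq_zero (Filter.Eventually.of_forall fun y => ?_)
      rw [Real.smoothTransition.one_of_one_le (not_lt.1 fun h1 => h ⟨h0, h1.le⟩)]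
      exact Real.smoothTransition.le_one y

/-- Up to a partial derivative of a smooth compactly supported function, one variable of a smooth
compactly supported function may be integrated out against a fixed bump function. -/
theorem exists_fderiv_single_eq_sub_integral_update {ι : Type*} [Fintype ι] [DecidableEq ι]
    {f : (ι → ℝ) → ℝ} (hf : ContDiff ℝ ∞ f) (hsupp : HasCompactSupport f) (i : ι) :
    ∃ G : (ι → ℝ) → ℝ, ContDiff ℝ ∞ G ∧ HasCompactSupport G ∧
      ∀ x, fderiv ℝ G x (Pi.single i 1) =
        f x - deriv Real.smoothTransition (x i) * ∫ t, f (update x i t) := by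
  obtain ⟨R, hR1, hR⟩ := hsupp.exists_eq_zero_of_le_abs_apply
  have hR0 : 0 ≤ R := zero_le_one.trans hR1
  have hP := contDiff_intervalIntegral_update hf hR i
  have hM : ContDiff ℝ ∞ fun x => ∫ t, f (update x i t) := by
    have h := hP.comp ((contDiff_update_prod i).comp
      (contDiff_id.prodMk (contDiff_const (c := R))))
    convert h using 2 with x
    simpa using (intervalIntegral_update_eq_integral hR x i le_rfl).symm
  have hθ : ContDiff ℝ ∞ Real.smoothTransition := Real.smoothTransition.contDiff
  have hG : ContDiff ℝ ∞ fun x => (∫ t in (-R)..(x i), f (update x i t)) -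
      Real.smoothTransition (x i) * ∫ t, f (update x i t) :=
    hP.sub ((hθ.comp (contDiff_apply ℝ ℝ i)).mul hM)
  refine ⟨_, hG, HasCompactSupport.of_eq_zero_of_le_abs_apply hR0 ?_, fun x => ?_⟩
  · intro x j hj
    rcases eq_or_ne j i with rfl | hji
    · rcases le_abs.1 hj with h | h
      · rw [intervalIntegral_update_eq_integral hR x j h,
          Real.smoothTransition.one_of_one_le (hR1.trans h), one_mul, sub_self]
      · rw [Real.smoothTransition.zero_of_nonpos (by linarith), zero_mul, sub_zero,
          intervalIntegral.integral_symm, neg_eq_zero]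
        refine intervalIntegral.integral_zero_ae (Filter.Eventually.of_forall fun t ht => ?_)
        rw [uIoc_of_le (by linarith)] at ht
        exact hR _ j (by simpa using le_abs.2 (Or.inr (by linarith [ht.2])))
    · have h0 (t : ℝ) : f (update x i t) = 0 := hR _ j (by simpa [update_of_ne hji] using hj)
      simp [h0]
  · have hcurve := hasDerivAt_update x i (x i)
    have hGd := (hG.differentiable (by simp)).differentiableAt (x := update x i (x i))
    have h₁ := hGd.hasFDerivAt.comp_hasDerivAt (x i) hcurve
    rw [update_eq_self] at h₁
    have hcont : Continuous fun t => f (update x i t) :=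
      hf.continuous.comp (continuous_const.update i continuous_id)
    have h₂ := (intervalIntegral.integral_hasDerivAt_right
      (hcont.intervalIntegrable (-R) (x i)) (hcont.stronglyMeasurableAtFilter _ _)
      hcont.continuousAt).sub
        (((hθ.differentiable (by simp)).differentiableAt (x := x i)).hasDerivAt.mul_const
          (∫ t, f (update x i t)))
    rw [update_eq_self] at h₂
    refine h₁.unique (h₂.congr_of_eventuallyEq (Filter.Eventually.of_forall fun s => ?_))
    simp

theorem integral_fderiv_apply_eq_zero {E : Type*} [NormedAddCommGroup E] [NormedSpace ℝ E]
    [MeasurableSpace E] [BorelSpace E] [FiniteDimensional ℝ E] {μ : Measure E}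
    [μ.IsAddHaarMeasure] {G : E → ℝ} (hG : ContDiff ℝ 1 G) (hsupp : HasCompactSupport G) (v : E) :
    ∫ x, fderiv ℝ G x v ∂μ = 0 := by
  have h := integral_mul_fderiv_eq_neg_fderiv_mul_of_integrable (𝕜 := ℝ) (μ := μ)
    (f := fun _ => 1) (g := G) (v := v) (by simp)
    (by simpa using ((hG.continuous_fderiv one_ne_zero).clm_apply
      continuous_const).integrable_of_hasCompactSupport (hsupp.fderiv_apply (𝕜 := ℝ) v))
    (by simpa using hG.continuous.integrable_of_hasCompactSupport hsupp)
    (fun _ _ => differentiableAt_const _)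
    (fun _ _ => (hG.differentiable one_ne_zero).differentiableAt)
  simpa using h

/-- Up to a divergence, any finite set of variables may be integrated out. -/
theorem exists_divergence_add_prod_mul {ι : Type*} [Fintype ι] [DecidableEq ι]
    {f : (ι → ℝ) → ℝ} (hf : ContDiff ℝ ∞ f) (hsupp : HasCompactSupport f) (S : Finset ι) :
    ∃ (F : ι → (ι → ℝ) → ℝ) (g : (ι → ℝ) → ℝ),
      (∀ i, ContDiff ℝ ∞ (F i) ∧ HasCompactSupport (F i)) ∧
      (∀ x y, (∀ j ∉ S, x j = y j) → g x = g y) ∧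
      ∀ x, f x = (∑ i, fderiv ℝ (F i) x (Pi.single i 1)) +
        (∏ i ∈ S, deriv Real.smoothTransition (x i)) * g x := by
  induction S using Finset.induction_on with
  | empty =>
    refine ⟨fun _ _ => 0, f, fun i => ⟨contDiff_const, HasCompactSupport.zero⟩, ?_, ?_⟩
    · intro x y h
      rw [funext fun j => h j (by simp)]
    · simp
  | insert i S hi ih =>
    obtain ⟨F, g, hF, hg, hfg⟩ := ih
    set h : (ι → ℝ) → ℝ := fun x => (∏ i ∈ S, deriv Real.smoothTransition (x i)) * g x with hh
    have heq : h = fun x => f x - ∑ i, fderiv ℝ (F i) x (Pi.single i 1) := by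
      funext x
      rw [hfg x, add_sub_cancel_left]
    have hsm : ContDiff ℝ ∞ h := by
      rw [heq]
      exact hf.sub (ContDiff.sum fun i _ =>
        ((hF i).1.fderiv_right (m := ∞) (by simp)).clm_apply contDiff_const)
    have hcs : HasCompactSupport h := by
      have hsum : HasCompactSupport fun x => ∑ i, fderiv ℝ (F i) x (Pi.single i 1) := by
        have H := Finset.sum_induction (s := Finset.univ)
          (fun i x => fderiv ℝ (F i) x (Pi.single i 1)) HasCompactSupport
          (fun a b ha hb => ha.add hb) HasCompactSupport.zero
          (fun i _ => (hF i).2.fderiv_apply (𝕜 := ℝ) _)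
        convert H using 1
        ext x
        simp
      rw [heq]
      exact hsupp.sub hsum
    obtain ⟨G, hG, hGs, hGd⟩ := exists_fderiv_single_eq_sub_integral_update hsm hcs i
    refine ⟨fun j => F j + Pi.single (M := fun _ => (ι → ℝ) → ℝ) i G j,
      fun x => ∫ t, g (update x i t), ?_, ?_, ?_⟩
    · intro j
      rcases eq_or_ne j i with rfl | hj
      · simpa using ⟨(hF j).1.add hG, (hF j).2.add hGs⟩
      · simpa [hj] using hF j
    · intro x y hxy
      refine integral_congr_ae (Filter.Eventually.of_forall fun t => hg _ _ fun j hj => ?_)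
      rcases eq_or_ne j i with rfl | hji
      · simp
      · simp [hji, hxy j (by simp [hji, hj])]
    · intro x
      have hint : ∫ t, h (update x i t) =
          (∏ j ∈ S, deriv Real.smoothTransition (x j)) * ∫ t, g (update x i t) := by
        rw [← integral_const_mul]
        refine integral_congr_ae (Filter.Eventually.of_forall fun t => ?_)
        simp only [hh]
        congr 1
        refine Finset.prod_congr rfl fun j hj => ?_
        rw [update_of_ne (ne_of_mem_of_not_mem hj hi)]
      have hsum : ∑ j, fderiv ℝ (F j + Pi.single (M := fun _ => (ι → ℝ) → ℝ) i G j) x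
            (Pi.single j 1) =
          (∑ j, fderiv ℝ (F j) x (Pi.single j 1)) + fderiv ℝ G x (Pi.single i 1) := by
        rw [← Finset.sum_add_sum_compl {i}, ← Finset.sum_add_sum_compl {i} fun j =>
          fderiv ℝ (F j) x (Pi.single j 1), Finset.sum_singleton, Finset.sum_singleton,
          Pi.single_eq_same, fderiv_add ((hF i).1.differentiable (by simp)).differentiableAt
            (hG.differentiable (by simp)).differentiableAt, add_right_comm]
        congr 1
        refine Finset.sum_congr rfl fun j hj => ?_
        rw [Pi.single_eq_of_ne (by simpa using hj), add_zero]
      rw [hsum, hGd, hint, Finset.prod_insert hi, hfg x]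
      simp only [hh]
      ring

end CompactlySupportedDivergence

/-- Let `d ≥ 1`. For every smooth, compactly supported `f : ℝ^d → ℝ` with `∫ f = 0`,
there exist smooth, compactly supported `F₁, …, F_d : ℝ^d → ℝ` such that
`∑ i, ∂_{x_i} F_i = f` on `ℝ^d`; that is, `f` is the divergence of a smooth compactly
supported vector field. -/
theorem stmt_17 (d : ℕ) (hd : 1 ≤ d) (f : (Fin d → ℝ) → ℝ)
    (hsm : ContDiff ℝ ((⊤ : ℕ∞) : WithTop ℕ∞) f) (hsupp : HasCompactSupport f)
    (hf : (∫ x : Fin d → ℝ, f x) = 0) :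
    ∃ F : Fin d → ((Fin d → ℝ) → ℝ),
      (∀ i, ContDiff ℝ ((⊤ : ℕ∞) : WithTop ℕ∞) (F i) ∧ HasCompactSupport (F i)) ∧
      ∀ x : Fin d → ℝ, (∑ i, fderiv ℝ (F i) x (Pi.single i 1)) = f x := by
  obtain ⟨F, g, hF, hg, hfg⟩ := exists_divergence_add_prod_mul hsm hsupp Finset.univ
  refine ⟨F, hF, fun x => ?_⟩
  have hconst (y : Fin d → ℝ) : g y = g x := hg y x (by simp)
  have hF1 (i : Fin d) : ContDiff ℝ 1 (F i) := (hF i).1.of_le (by simp)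
  have hint (i : Fin d) : Integrable fun y => fderiv ℝ (F i) y (Pi.single i 1) :=
    (((hF1 i).continuous_fderiv one_ne_zero).clm_apply
      continuous_const).integrable_of_hasCompactSupport ((hF i).2.fderiv_apply (𝕜 := ℝ) _)
  have hdiv : ∫ y, ∑ i, fderiv ℝ (F i) y (Pi.single i 1) = 0 := by
    rw [integral_finsetSum _ fun i _ => hint i]
    exact Finset.sum_eq_zero fun i _ => integral_fderiv_apply_eq_zero (hF1 i) (hF i).2 _
  have hzero : g x = 0 := by
    have hrem : ∫ y : Fin d → ℝ, (f y - ∑ i, fderiv ℝ (F i) y (Pi.single i 1)) = g x := by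
      simp_rw [hfg, hconst, add_sub_cancel_left]
      rw [integral_mul_const, integral_fintype_prod_volume_eq_pow,
        Real.smoothTransition.integral_deriv, one_pow, one_mul]
    rw [← hrem, integral_sub (hsm.continuous.integrable_of_hasCompactSupport hsupp)
      (integrable_finsetSum _ fun i _ => hint i), hf, hdiv, sub_zero]
  rw [hfg x, hzero, mul_zero, add_zero]
end
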